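/- Let f ∈ 𝓒 and θ₀ ∈ ℝ, and let π be drawn from Q_{n,f,θ₀}. Define LD_n(π,t) := (1/n) ∑_{i=1}^n f(i/n, π(i)/n) − μ_{f,t}[f] and ML_n(π,t) := (1/n) ∑_{i=1}^n f(i/n, π(i)/n) − (1/n)(d/dt)Z_n(f,t). Then Q_{n,f,θ₀}({π : t ↦ LD_n(π,t) has exactly one zero in ℝ}) → 1 as n → ∞, and for every δ > 0, Q_{n,f,θ₀}({π : there exists t with LD_n(π,t) = 0 and |t − θ₀| > δ}) → 0; the same two assertions hold with ML_n in place of LD_n. In other words, the MLE and the estimator based on the limiting log normalizing constant are well-defined with probability tending to one and are consistent for θ₀. -/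

import Mathlib

open MeasureTheory Filter Topology
open scoped ENNReal

noncomputable section

/-- The unit square `[0,1]²` in `ℝ × ℝ`. -/
def unitSq : Set (ℝ × ℝ) := Set.Icc 0 1 ×ˢ Set.Icc 0 1

/-- Lebesgue measure restricted to `[0,1]`. -/
def unif01 : Measure ℝ := volume.restrict (Set.Icc 0 1)

/-- Lebesgue (uniform) measure on the unit square. -/
def usq : Measure (ℝ × ℝ) := unif01.prod unif01

/-- `𝓜`: Borel probability measures on `[0,1]²` with both marginals Lebesgue on `[0,1]`. -/
def MM : Set (Measure (ℝ × ℝ)) :=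
  {μ | IsProbabilityMeasure μ ∧ μ.map Prod.fst = unif01 ∧ μ.map Prod.snd = unif01}

/-- The class `𝓒` of continuous functions on the unit square, not identically zero,
with all row and column integrals vanishing. -/
def memC (f : ℝ × ℝ → ℝ) : Prop :=
  ContinuousOn f unitSq ∧ (∃ p ∈ unitSq, f p ≠ 0) ∧
    (∀ x ∈ Set.Icc (0 : ℝ) 1, (∫ z in (0 : ℝ)..1, f (x, z)) = 0) ∧
    (∀ y ∈ Set.Icc (0 : ℝ) 1, (∫ z in (0 : ℝ)..1, f (z, y)) = 0)

open scoped Classical in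
/-- Kullback–Leibler divergence `D(μ‖ν)`, equal to `∫ log(dμ/dν) dμ` when `μ ≪ ν`
(and this integral exists), and `+∞` otherwise. -/
def KL (μ ν : Measure (ℝ × ℝ)) : ℝ≥0∞ :=
  if μ ≪ ν ∧ Integrable (fun x => Real.log ((μ.rnDeriv ν x).toReal)) μ then
    ENNReal.ofReal (∫ x, Real.log ((μ.rnDeriv ν x).toReal) ∂μ)
  else ⊤

/-- The objective `θ μ[f] − D(μ‖u)`, as an extended real. -/
def objE (f : ℝ × ℝ → ℝ) (θ : ℝ) (μ : Measure (ℝ × ℝ)) : EReal :=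
  ((θ * ∫ p, f p ∂μ : ℝ) : EReal) - (KL μ usq : EReal)

/-- `∑_{i=1}^n f(i/n, π(i)/n)`. -/
def permStat (f : ℝ × ℝ → ℝ) (n : ℕ) (π : Equiv.Perm (Fin n)) : ℝ :=
  ∑ i : Fin n, f ((i.1 + 1 : ℝ) / n, ((π i).1 + 1 : ℝ) / n)

/-- The log normalizing constant `Z_n(f,θ)`. -/
def Zn (f : ℝ × ℝ → ℝ) (θ : ℝ) (n : ℕ) : ℝ :=
  Real.log (∑ π : Equiv.Perm (Fin n), Real.exp (θ * permStat f n π))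

open scoped Classical in
/-- The probability that a sample from `Q_{n,f,θ}` satisfies `p`. -/
def Qprob (f : ℝ × ℝ → ℝ) (θ : ℝ) (n : ℕ) (p : Equiv.Perm (Fin n) → Prop) : ℝ :=
  ∑ π : Equiv.Perm (Fin n), if p π then Real.exp (θ * permStat f n π - Zn f θ n) else 0

instance isProbabilityMeasure_unif01 : IsProbabilityMeasure unif01 :=
  ⟨by simp [unif01]⟩

instance isProbabilityMeasure_usq : IsProbabilityMeasure usq := by
  unfold usq; infer_instance

/-- Real-valued densities, with respect to `usq`, of the measures in `𝓜`. -/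
structure IsDens (ρ : ℝ × ℝ → ℝ) : Prop where
  meas : Measurable ρ
  nonneg : ∀ p, 0 ≤ ρ p
  int : Integrable ρ usq
  fst : ∀ A, MeasurableSet A → ∫ p in Prod.fst ⁻¹' A, ρ p ∂usq = unif01.real A
  snd : ∀ A, MeasurableSet A → ∫ p in Prod.snd ⁻¹' A, ρ p ∂usq = unif01.real A

/-- The entropy `∫ ρ log ρ` of a density on the unit square. -/
def ent (ρ : ℝ × ℝ → ℝ) : ℝ := ∫ p, ρ p * Real.log (ρ p) ∂usq

/-- The measure with density `ρ` on the unit square. -/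
def densMeasure (ρ : ℝ × ℝ → ℝ) : Measure (ℝ × ℝ) :=
  usq.withDensity (fun p => ENNReal.ofReal (ρ p))

namespace IsDens

variable {ρ σ : ℝ × ℝ → ℝ}

lemma integral_eq_one (h : IsDens ρ) : ∫ p, ρ p ∂usq = 1 := by
  simpa using h.fst Set.univ MeasurableSet.univ

lemma densMeasure_apply (h : IsDens ρ) {A : Set (ℝ × ℝ)} (hA : MeasurableSet A) :
    densMeasure ρ A = ENNReal.ofReal (∫ p in A, ρ p ∂usq) := by
  rw [densMeasure, withDensity_apply _ hA, ofReal_integral_eq_lintegral_ofReal h.int.integrableOn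
    (ae_of_all _ h.nonneg)]

lemma mem_MM (h : IsDens ρ) : densMeasure ρ ∈ MM := by
  refine ⟨⟨?_⟩, ?_, ?_⟩
  · rw [h.densMeasure_apply MeasurableSet.univ, setIntegral_univ, h.integral_eq_one,
      ENNReal.ofReal_one]
  · ext A hA
    rw [Measure.map_apply measurable_fst hA, h.densMeasure_apply (measurable_fst hA), h.fst A hA,
      measureReal_def, ENNReal.ofReal_toReal (measure_ne_top _ _)]
  · ext A hA
    rw [Measure.map_apply measurable_snd hA, h.densMeasure_apply (measurable_snd hA), h.snd A hA,
      measureReal_def, ENNReal.ofReal_toReal (measure_ne_top _ _)]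

lemma isProbabilityMeasure (h : IsDens ρ) : IsProbabilityMeasure (densMeasure ρ) := h.mem_MM.1

lemma integral_densMeasure (h : IsDens ρ) (g : ℝ × ℝ → ℝ) :
    ∫ p, g p ∂(densMeasure ρ) = ∫ p, ρ p * g p ∂usq := by
  rw [densMeasure, integral_withDensity_eq_integral_toReal_smul h.meas.ennreal_ofReal
    (ae_of_all _ fun _ => ENNReal.ofReal_lt_top)]
  simp [ENNReal.toReal_ofReal (h.nonneg _)]

lemma integrable_densMeasure_iff (h : IsDens ρ) (g : ℝ × ℝ → ℝ) :
    Integrable g (densMeasure ρ) ↔ Integrable (fun p => ρ p * g p) usq := by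
  rw [densMeasure, integrable_withDensity_iff_integrable_smul' h.meas.ennreal_ofReal
    (ae_of_all _ fun _ => ENNReal.ofReal_lt_top)]
  simp [ENNReal.toReal_ofReal (h.nonneg _)]

lemma ent_nonneg (h : IsDens ρ) (hi : Integrable (fun p => ρ p * Real.log (ρ p)) usq) :
    0 ≤ ent ρ := by
  have h1 : ∫ p, (ρ p - 1) ∂usq = 0 := by
    rw [integral_sub h.int (integrable_const _), h.integral_eq_one]; simp
  rw [← h1, ent]
  refine integral_mono (h.int.sub (integrable_const _)) hi fun p => ?_
  rcases (h.nonneg p).eq_or_lt with h0 | h0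
  · simp [← h0]
  · have := Real.one_sub_inv_le_log_of_pos h0
    calc ρ p - 1 = ρ p * (1 - (ρ p)⁻¹) := by field_simp
      _ ≤ _ := by gcongr

lemma rnDeriv_densMeasure (h : IsDens ρ) :
    (fun p => Real.log ((densMeasure ρ).rnDeriv usq p).toReal) =ᵐ[densMeasure ρ]
      fun p => Real.log (ρ p) := by
  have := Measure.rnDeriv_withDensity usq h.meas.ennreal_ofReal
  refine (withDensity_absolutelyContinuous usq _).ae_le ?_
  filter_upwards [this] with p hp
  rw [densMeasure, hp, ENNReal.toReal_ofReal (h.nonneg p)]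

lemma KL_densMeasure (h : IsDens ρ) (hi : Integrable (fun p => ρ p * Real.log (ρ p)) usq) :
    KL (densMeasure ρ) usq = ENNReal.ofReal (ent ρ) := by
  rw [KL, if_pos, integral_congr_ae h.rnDeriv_densMeasure, h.integral_densMeasure, ent]
  refine ⟨withDensity_absolutelyContinuous usq _, ?_⟩
  rw [integrable_congr h.rnDeriv_densMeasure, h.integrable_densMeasure_iff]
  exact hi

lemma of_mem_MM (hm : Measurable ρ) (h0 : ∀ p, 0 ≤ ρ p) (h : densMeasure ρ ∈ MM) : IsDens ρ := by
  have hprob := h.1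
  have hint : Integrable ρ usq := by
    refine ⟨hm.aestronglyMeasurable, ?_⟩
    rw [hasFiniteIntegral_iff_ofReal (ae_of_all _ h0), ← setLIntegral_univ,
      ← withDensity_apply _ MeasurableSet.univ]
    exact measure_lt_top (densMeasure ρ) _
  have key : ∀ A, MeasurableSet A → ∫ p in A, ρ p ∂usq = (densMeasure ρ).real A := by
    intro A hA
    rw [integral_eq_lintegral_of_nonneg_ae (ae_of_all _ h0) hm.aestronglyMeasurable,
      measureReal_def, densMeasure, withDensity_apply _ hA]
  refine ⟨hm, h0, hint, fun A hA => ?_, fun A hA => ?_⟩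
  · rw [key _ (measurable_fst hA), ← h.2.1, measureReal_def, measureReal_def,
      Measure.map_apply measurable_fst hA]
  · rw [key _ (measurable_snd hA), ← h.2.2, measureReal_def, measureReal_def,
      Measure.map_apply measurable_snd hA]

lemma one : IsDens (fun _ => 1) := by
  refine ⟨measurable_const, by simp, integrable_const _, fun A hA => ?_, fun A hA => ?_⟩
  · have : Prod.fst ⁻¹' A = A ×ˢ (Set.univ : Set ℝ) := by ext; simp
    simp [this, usq, measureReal_def]
  · have : Prod.snd ⁻¹' A = (Set.univ : Set ℝ) ×ˢ A := by ext; simp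
    simp [this, usq, measureReal_def]

lemma convexComb (hρ : IsDens ρ) (hσ : IsDens σ) {a b : ℝ} (ha : 0 ≤ a) (hb : 0 ≤ b)
    (hab : a + b = 1) : IsDens (fun p => a * ρ p + b * σ p) := by
  refine ⟨(hρ.meas.const_mul a).add (hσ.meas.const_mul b), fun p => ?_,
    (hρ.int.const_mul a).add (hσ.int.const_mul b), fun A hA => ?_, fun A hA => ?_⟩
  · have := hρ.nonneg p
    have := hσ.nonneg p
    positivity
  · rw [integral_add (hρ.int.const_mul a).integrableOn (hσ.int.const_mul b).integrableOn,
      integral_const_mul, integral_const_mul, hρ.fst A hA, hσ.fst A hA, ← add_mul, hab, one_mul]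
  · rw [integral_add (hρ.int.const_mul a).integrableOn (hσ.int.const_mul b).integrableOn,
      integral_const_mul, integral_const_mul, hρ.snd A hA, hσ.snd A hA, ← add_mul, hab, one_mul]

lemma add_of_integral_eq_zero (hρ : IsDens ρ) {k : ℝ × ℝ → ℝ} (hk : Measurable k)
    (hki : Integrable k usq) (h0 : ∀ p, 0 ≤ ρ p + k p)
    (h1 : ∀ A, MeasurableSet A → ∫ p in Prod.fst ⁻¹' A, k p ∂usq = 0)
    (h2 : ∀ A, MeasurableSet A → ∫ p in Prod.snd ⁻¹' A, k p ∂usq = 0) :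
    IsDens (fun p => ρ p + k p) := by
  refine ⟨hρ.meas.add hk, h0, hρ.int.add hki, fun A hA => ?_, fun A hA => ?_⟩
  · rw [integral_add hρ.int.integrableOn hki.integrableOn, hρ.fst A hA, h1 A hA, add_zero]
  · rw [integral_add hρ.int.integrableOn hki.integrableOn, hρ.snd A hA, h2 A hA, add_zero]

end IsDens

lemma exists_isDens_of_KL_ne_top {μ : Measure (ℝ × ℝ)} (hμ : μ ∈ MM) (h : KL μ usq ≠ ⊤) :
    ∃ ρ, IsDens ρ ∧ Integrable (fun p => ρ p * Real.log (ρ p)) usq ∧ μ = densMeasure ρ := by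
  have hprob := hμ.1
  have hc : μ ≪ usq ∧ Integrable (fun x => Real.log ((μ.rnDeriv usq x).toReal)) μ := by
    by_contra hc
    exact h (by rw [KL, if_neg hc])
  have hμeq : μ = densMeasure (fun p => (μ.rnDeriv usq p).toReal) := by
    conv_lhs => rw [← Measure.withDensity_rnDeriv_eq _ _ hc.1]
    refine withDensity_congr_ae ?_
    filter_upwards [Measure.rnDeriv_lt_top μ usq] with p hp
    rw [ENNReal.ofReal_toReal hp.ne]
  have hd : IsDens (fun p => (μ.rnDeriv usq p).toReal) :=
    IsDens.of_mem_MM (Measure.measurable_rnDeriv _ _).ennreal_toReal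
      (fun _ => ENNReal.toReal_nonneg) (hμeq ▸ hμ)
  refine ⟨_, hd, ?_, hμeq⟩
  rw [← hd.integrable_densMeasure_iff, ← hμeq]
  exact hc.2

/-- The density `ρ` maximizes `t ∫ f ρ - ∫ ρ log ρ` among densities with uniform marginals. -/
structure IsOpt (f : ℝ × ℝ → ℝ) (t : ℝ) (ρ : ℝ × ℝ → ℝ) : Prop where
  dens : IsDens ρ
  int : Integrable (fun p => ρ p * Real.log (ρ p)) usq
  le : ∀ σ, IsDens σ → Integrable (fun p => σ p * Real.log (σ p)) usq →
    t * (∫ p, σ p * f p ∂usq) - ent σ ≤ t * (∫ p, ρ p * f p ∂usq) - ent ρ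

lemma objE_densMeasure (f : ℝ × ℝ → ℝ) (t : ℝ) {ρ : ℝ × ℝ → ℝ} (h : IsDens ρ)
    (hi : Integrable (fun p => ρ p * Real.log (ρ p)) usq) :
    objE f t (densMeasure ρ) = ((t * (∫ p, ρ p * f p ∂usq) - ent ρ : ℝ) : EReal) := by
  rw [objE, h.KL_densMeasure hi, h.integral_densMeasure, EReal.coe_ennreal_ofReal,
    max_eq_left (h.ent_nonneg hi), ← EReal.coe_sub]

lemma exists_isOpt {f : ℝ × ℝ → ℝ} {t : ℝ} {μ : Measure (ℝ × ℝ)} (hμ : μ ∈ MM)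
    (hmax : ∀ ν ∈ MM, objE f t ν ≤ objE f t μ) :
    ∃ ρ, IsOpt f t ρ ∧ ∫ p, f p ∂μ = ∫ p, ρ p * f p ∂usq := by
  have hKL : KL μ usq ≠ ⊤ := by
    intro htop
    have h1 := hmax _ IsDens.one.mem_MM
    rw [objE_densMeasure f t IsDens.one (by simp), objE, htop, EReal.coe_ennreal_top,
      EReal.sub_top] at h1
    exact absurd (le_bot_iff.1 h1) (EReal.coe_ne_bot _)
  obtain ⟨ρ, hρ, hi, rfl⟩ := exists_isDens_of_KL_ne_top hμ hKL
  refine ⟨ρ, ⟨hρ, hi, fun σ hσ hσi => ?_⟩, hρ.integral_densMeasure f⟩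
  have := hmax _ hσ.mem_MM
  rwa [objE_densMeasure f t hσ hσi, objE_densMeasure f t hρ hi, EReal.coe_le_coe_iff] at this

lemma neg_one_le_mul_log {x : ℝ} (hx : 0 ≤ x) : -1 ≤ x * Real.log x := by
  have := Real.self_sub_one_le_mul_log hx
  linarith

lemma integrable_mul_log_of_le {σ b : ℝ × ℝ → ℝ} (hσ : Measurable σ) (h0 : ∀ p, 0 ≤ σ p)
    (hb : Integrable b usq) (hle : ∀ p, σ p * Real.log (σ p) ≤ b p) :
    Integrable (fun p => σ p * Real.log (σ p)) usq := by
  refine (hb.abs.add (integrable_const (1 : ℝ))).mono'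
    (hσ.mul hσ.log).aestronglyMeasurable (ae_of_all _ fun p => ?_)
  have h1 := neg_one_le_mul_log (h0 p)
  have h2 := hle p
  have h3 := le_abs_self (b p)
  have h4 := abs_nonneg (b p)
  rw [Real.norm_eq_abs, abs_le]
  constructor <;> simp only [Pi.add_apply] <;> linarith

lemma mul_log_sub_ge {p m : ℝ} (hp : 0 ≤ p) (hm : 0 < m) (b : ℝ) :
    p * b - m * (Real.exp b - 1) ≤ p * Real.log p - p * Real.log m - p + m := by
  rcases hp.eq_or_lt with rfl | hp
  · have := Real.exp_pos b
    nlinarith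
  · have hpos : 0 < p / (m * Real.exp b) := by positivity
    have h1 := Real.one_sub_inv_le_log_of_pos hpos
    rw [Real.log_div hp.ne' (by positivity), Real.log_mul hm.ne' (Real.exp_pos b).ne',
      Real.log_exp, inv_div] at h1
    have h2 := mul_le_mul_of_nonneg_left h1 hp.le
    have h3 : p * (1 - m * Real.exp b / p) = p - m * Real.exp b := by field_simp
    rw [h3] at h2
    linarith

lemma cosh_sub_one_le {a : ℝ} (ha : |a| ≤ 1) : Real.exp a + Real.exp (-a) - 2 ≤ 2 * a ^ 2 := by
  have h1 := Real.abs_exp_sub_one_sub_id_le ha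
  have h2 := Real.abs_exp_sub_one_sub_id_le (x := -a) (by rwa [abs_neg])
  have := (abs_le.1 h1).2
  have := (abs_le.1 h2).2
  nlinarith

lemma midpoint_mul_log_gain {p q a : ℝ} (hp : 0 ≤ p) (hq : 0 ≤ q) (ha : |a| ≤ 1) :
    a * (p - q) - a ^ 2 * (p + q) ≤ p * Real.log p + q * Real.log q
      - 2 * ((1 / 2 * p + 1 / 2 * q) * Real.log (1 / 2 * p + 1 / 2 * q)) := by
  rcases (add_nonneg hp hq).eq_or_lt with h0 | h0
  · have : p = 0 := by linarith
    have : q = 0 := by linarith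
    subst_vars; simp
  · have hm : 0 < 1 / 2 * p + 1 / 2 * q := by linarith
    have h1 := mul_log_sub_ge hp hm a
    have h2 := mul_log_sub_ge hq hm (-a)
    have h3 := mul_le_mul_of_nonneg_left (cosh_sub_one_le ha) hm.le
    nlinarith

lemma mul_log_add_le {x u : ℝ} (hx : 0 < x) (hu : -u ≤ x) :
    (x + u) * Real.log (x + u) ≤ (x + u) * (Real.log x + u / x) := by
  rcases (neg_le_iff_add_nonneg.1 hu).eq_or_lt with h | h
  · rw [← h]; simp
  · have h1 : x + u = x * (1 + u / x) := by field_simp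
    have h2 : 0 < 1 + u / x := by
      rw [h1] at h; exact (pos_iff_pos_of_mul_pos h).1 hx
    have h3 := Real.log_le_sub_one_of_pos h2
    have h4 : Real.log (x + u) = Real.log x + Real.log (1 + u / x) := by
      rw [h1, Real.log_mul hx.ne' h2.ne']
    rw [h4]
    exact mul_le_mul_of_nonneg_left (by linarith) h.le

lemma mul_log_symm_le {x u ε : ℝ} (hx : 0 ≤ x) (hε : ε ≤ 1) (hu : |u| ≤ ε * x) :
    (x + u) * Real.log (x + u) + (x - u) * Real.log (x - u) ≤
      2 * (x * Real.log x) + 2 * ε ^ 2 * x := by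
  rcases hx.eq_or_lt with rfl | hx
  · have : u = 0 := by simpa using hu
    simp [this]
  · have hu' : |u| ≤ x := hu.trans (by nlinarith)
    have h1 := mul_log_add_le (u := u) hx (by linarith [(abs_le.1 hu').1])
    have h2 := mul_log_add_le (u := -u) hx (by linarith [(abs_le.1 hu').2])
    have h3 : (x + u) * (Real.log x + u / x) + (x + -u) * (Real.log x + -u / x) =
        2 * (x * Real.log x) + 2 * (u ^ 2 / x) := by field_simp; ring
    have h4 : u ^ 2 / x ≤ ε ^ 2 * x := by
      rw [div_le_iff₀ hx, ← sq_abs]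
      calc |u| ^ 2 ≤ (ε * x) ^ 2 := by gcongr
        _ = _ := by ring
    rw [sub_eq_add_neg]
    linarith

section bounded

variable {f : ℝ × ℝ → ℝ} {M : ℝ}

lemma IsDens.integrable_mul {ρ : ℝ × ℝ → ℝ} (h : IsDens ρ) (hf : Measurable f)
    (hM : ∀ p, |f p| ≤ M) : Integrable (fun p => ρ p * f p) usq :=
  h.int.mul_bdd hf.aestronglyMeasurable (ae_of_all _ hM)

lemma IsDens.abs_integral_mul_le {ρ : ℝ × ℝ → ℝ} (h : IsDens ρ) 
    (hM : ∀ p, |f p| ≤ M) : |∫ p, ρ p * f p ∂usq| ≤ M := by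
  have := h.isProbabilityMeasure
  rw [← h.integral_densMeasure]
  simpa using norm_integral_le_of_norm_le_const (μ := densMeasure ρ) (f := f)
    (ae_of_all _ fun p => by simpa using hM p)

lemma IsOpt.strong_monotone {ρ σ : ℝ × ℝ → ℝ} {s t lam : ℝ} (hf : Measurable f)
    (hM : ∀ p, |f p| ≤ M) (hρ : IsOpt f s ρ) (hσ : IsOpt f t σ) (hlam : |lam| * M ≤ 1) :
    lam * ((∫ p, ρ p * f p ∂usq) - ∫ p, σ p * f p ∂usq) - 2 * lam ^ 2 * M ^ 2 ≤
      (t - s) * ((∫ p, σ p * f p ∂usq) - ∫ p, ρ p * f p ∂usq) / 2 := by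
  have hM0 : 0 ≤ M := (abs_nonneg _).trans (hM 0)
  set τ : ℝ × ℝ → ℝ := fun p => 1 / 2 * ρ p + 1 / 2 * σ p with hτ
  have hτd : IsDens τ := hρ.dens.convexComb hσ.dens (by norm_num) (by norm_num) (by norm_num)
  have hpt : ∀ p, (lam * f p) * (ρ p - σ p) - lam ^ 2 * M ^ 2 * (ρ p + σ p) ≤
      ρ p * Real.log (ρ p) + σ p * Real.log (σ p) - 2 * (τ p * Real.log (τ p)) := by
    intro p
    have ha : |lam * f p| ≤ 1 := by
      rw [abs_mul]
      exact (mul_le_mul_of_nonneg_left (hM p) (abs_nonneg _)).trans hlam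
    refine le_trans ?_ (midpoint_mul_log_gain (hρ.dens.nonneg p) (hσ.dens.nonneg p) ha)
    have h1 := hρ.dens.nonneg p
    have h2 := hσ.dens.nonneg p
    have h3 : f p ^ 2 ≤ M ^ 2 := by rw [← sq_abs]; gcongr; exact hM p
    rw [mul_pow]
    gcongr
  have hτi : Integrable (fun p => τ p * Real.log (τ p)) usq := by
    refine integrable_mul_log_of_le hτd.meas hτd.nonneg
      ((hρ.int.const_mul (1 / 2)).add (hσ.int.const_mul (1 / 2))) fun p => ?_
    have := Real.convexOn_mul_log.2 (hρ.dens.nonneg p) (hσ.dens.nonneg p)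
      (show (0 : ℝ) ≤ 1 / 2 by norm_num) (show (0 : ℝ) ≤ 1 / 2 by norm_num) (by norm_num)
    simpa [hτ] using this
  have hρf := hρ.dens.integrable_mul hf hM
  have hσf := hσ.dens.integrable_mul hf hM
  have hτf : ∫ p, τ p * f p ∂usq =
      1 / 2 * (∫ p, ρ p * f p ∂usq) + 1 / 2 * ∫ p, σ p * f p ∂usq := by
    rw [← integral_const_mul, ← integral_const_mul,
      ← integral_add (hρf.const_mul _) (hσf.const_mul _)]
    congr 1; ext p; simp only [hτ]; ring
  have hint : lam * ((∫ p, ρ p * f p ∂usq) - ∫ p, σ p * f p ∂usq) - 2 * lam ^ 2 * M ^ 2 ≤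
      ent ρ + ent σ - 2 * ent τ := by
    have e1 : ∫ p, (ρ p * Real.log (ρ p) + σ p * Real.log (σ p) - 2 * (τ p * Real.log (τ p))) ∂usq
        = ent ρ + ent σ - 2 * ent τ := by
      have h1 : Integrable (fun p => ρ p * Real.log (ρ p) + σ p * Real.log (σ p)) usq :=
        hρ.int.add hσ.int
      rw [integral_sub h1 (hτi.const_mul _), integral_add hρ.int hσ.int,
        integral_const_mul]; rfl
    have e2 : ∫ p, (lam * (ρ p * f p - σ p * f p) - lam ^ 2 * M ^ 2 * (ρ p + σ p)) ∂usq
        = lam * ((∫ p, ρ p * f p ∂usq) - ∫ p, σ p * f p ∂usq) - 2 * lam ^ 2 * M ^ 2 := by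
      have h1 : Integrable (fun p => ρ p * f p - σ p * f p) usq := hρf.sub hσf
      have h2 : Integrable (fun p => ρ p + σ p) usq := hρ.dens.int.add hσ.dens.int
      rw [integral_sub (h1.const_mul _) (h2.const_mul _),
        integral_const_mul, integral_const_mul, integral_sub hρf hσf,
        integral_add hρ.dens.int hσ.dens.int, hρ.dens.integral_eq_one, hσ.dens.integral_eq_one]
      ring
    rw [← e1, ← e2]
    refine integral_mono (((hρf.sub hσf).const_mul _).sub
      ((hρ.dens.int.add hσ.dens.int).const_mul _))
      ((hρ.int.add hσ.int).sub (hτi.const_mul _)) fun p => ?_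
    refine le_trans (le_of_eq ?_) (hpt p)
    ring
  have h1 := hρ.le τ hτd hτi
  have h2 := hσ.le τ hτd hτi
  rw [hτf] at h1 h2
  linarith

lemma IsOpt.sq_sub_le {ρ σ : ℝ × ℝ → ℝ} {s t : ℝ} (hf : Measurable f) (hM0 : 0 < M)
    (hM : ∀ p, |f p| ≤ M) (hρ : IsOpt f s ρ) (hσ : IsOpt f t σ) :
    ((∫ p, σ p * f p ∂usq) - ∫ p, ρ p * f p ∂usq) ^ 2 ≤
      4 * M ^ 2 * ((t - s) * ((∫ p, σ p * f p ∂usq) - ∫ p, ρ p * f p ∂usq)) := by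
  set d := (∫ p, σ p * f p ∂usq) - ∫ p, ρ p * f p ∂usq with hd
  have h1 := hρ.dens.abs_integral_mul_le hM
  have h2 := hσ.dens.abs_integral_mul_le hM
  have hdM : |d| ≤ 2 * M := by
    rw [hd]; exact (abs_sub _ _).trans (by linarith)
  have h3 := IsOpt.strong_monotone (lam := -d / (4 * M ^ 2)) hf hM hρ hσ (by
    rw [abs_div, abs_neg, abs_of_pos (show 0 < 4 * M ^ 2 by positivity), div_mul_eq_mul_div,
      div_le_one (by positivity)]
    nlinarith)
  rw [← neg_sub (∫ p, σ p * f p ∂usq), ← hd] at h3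
  have h4 : -d / (4 * M ^ 2) * -d - 2 * (-d / (4 * M ^ 2)) ^ 2 * M ^ 2 = d ^ 2 / (8 * M ^ 2) := by
    field_simp; ring
  rw [h4, div_le_div_iff₀ (by positivity) (by norm_num)] at h3
  nlinarith

lemma IsOpt.ae_pos {ρ : ℝ × ℝ → ℝ} {t : ℝ} (hf : Measurable f)
    (hM : ∀ p, |f p| ≤ M) (hρ : IsOpt f t ρ) : ∀ᵐ p ∂usq, 0 < ρ p := by
  set N : Set (ℝ × ℝ) := {p | ρ p = 0} with hN
  have hNm : MeasurableSet N := hρ.dens.meas (measurableSet_singleton 0)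
  suffices h : usq N = 0 by
    rw [ae_iff]
    refine measure_mono_null (fun p hp => ?_) h
    exact le_antisymm (not_lt.1 hp) (hρ.dens.nonneg p)
  by_contra hne
  set a := usq.real N with ha
  have ha0 : 0 < a := ENNReal.toReal_pos hne (measure_ne_top _ _)
  set K := t * (∫ p, ρ p * f p ∂usq) - ent ρ - t * ∫ p, f p ∂usq with hK
  have hf1 : Integrable f usq := by simpa using IsDens.one.integrable_mul hf hM
  have key : ∀ ε : ℝ, 0 < ε → ε < 1 → -(a * Real.log ε) ≤ K := by
    intro ε h0 h1
    set σ : ℝ × ℝ → ℝ := fun p => (1 - ε) * ρ p + ε * 1 with hσ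
    have hσd : IsDens σ := hρ.dens.convexComb IsDens.one (by linarith) h0.le (by ring)
    have hle : ∀ p, σ p * Real.log (σ p) ≤
        (1 - ε) * (ρ p * Real.log (ρ p)) + N.indicator (fun _ => ε * Real.log ε) p := by
      intro p
      by_cases hp : p ∈ N
      · have : ρ p = 0 := hp
        simp [hσ, this, hp]
      · have := Real.convexOn_mul_log.2 (hρ.dens.nonneg p) (zero_le_one' ℝ)
          (show 0 ≤ 1 - ε by linarith) h0.le (by ring)
        simpa [hσ, hp] using this
    have hbi : Integrable (fun p => (1 - ε) * (ρ p * Real.log (ρ p)) +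
        N.indicator (fun _ => ε * Real.log ε) p) usq :=
      (hρ.int.const_mul _).add ((integrable_const _).indicator hNm)
    have hσi := integrable_mul_log_of_le hσd.meas hσd.nonneg hbi hle
    have hent : ent σ ≤ (1 - ε) * ent ρ + a * (ε * Real.log ε) := by
      refine (integral_mono hσi hbi hle).trans (le_of_eq ?_)
      rw [integral_add (hρ.int.const_mul _) ((integrable_const _).indicator hNm),
        integral_const_mul, integral_indicator_const _ hNm]; rfl
    have hσf : ∫ p, σ p * f p ∂usq = (1 - ε) * (∫ p, ρ p * f p ∂usq) + ε * ∫ p, f p ∂usq := by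
      rw [← integral_const_mul, ← integral_const_mul,
        ← integral_add ((hρ.dens.integrable_mul hf hM).const_mul _) (hf1.const_mul _)]
      congr 1; ext p; simp only [hσ]; ring
    have h2 := hρ.le σ hσd hσi
    rw [hσf] at h2
    have h3 : ε * -(a * Real.log ε) ≤ ε * K := by rw [hK]; linarith
    exact le_of_mul_le_mul_left h3 h0
  have := key (Real.exp (-((|K| + 1) / a))) (Real.exp_pos _)
    (Real.exp_lt_one_iff.2 (by rw [neg_lt_zero]; positivity))
  rw [Real.log_exp, mul_neg, neg_neg, mul_div_cancel₀ _ ha0.ne'] at this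
  linarith [le_abs_self K]

end bounded

/-- Exchanges the second coordinates of two points of the plane. -/
def swapSnd (z : (ℝ × ℝ) × ℝ × ℝ) : (ℝ × ℝ) × ℝ × ℝ := ((z.1.1, z.2.2), (z.2.1, z.1.2))

lemma measurePreserving_swapSnd : MeasurePreserving swapSnd (usq.prod usq) (usq.prod usq) := by
  have h1 : MeasurePreserving (fun z : ℝ × ℝ × ℝ => (z.2.2, (z.2.1, z.1)))
      (unif01.prod (unif01.prod unif01)) (unif01.prod (unif01.prod unif01)) := by
    have a : MeasurePreserving (Prod.swap : ℝ × ℝ × ℝ → _) (unif01.prod (unif01.prod unif01))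
      ((unif01.prod unif01).prod unif01) := Measure.measurePreserving_swap
    have b : MeasurePreserving (Prod.map Prod.swap id : (ℝ × ℝ) × ℝ → _)
      ((unif01.prod unif01).prod unif01) ((unif01.prod unif01).prod unif01) :=
      Measure.measurePreserving_swap.prod (MeasurePreserving.id _)
    exact (measurePreserving_prodAssoc unif01 unif01 unif01).comp (b.comp a)
  have h2 := (MeasurePreserving.id unif01).prod h1
  have h3 := measurePreserving_prodAssoc unif01 unif01 (unif01.prod unif01)
  exact (h3.symm MeasurableEquiv.prodAssoc).comp (h2.comp h3)

section kernel

variable (f r : ℝ × ℝ → ℝ)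

/-- The mixed second difference of `f` at the corners of a rectangle. -/
def mixedDiff (z : (ℝ × ℝ) × ℝ × ℝ) : ℝ :=
  f z.1 + f z.2 - f (z.1.1, z.2.2) - f (z.2.1, z.1.2)

/-- The mixed second difference of `f`, weighted by `r` at the corners. -/
def weightedDiff (z : (ℝ × ℝ) × ℝ × ℝ) : ℝ :=
  r z.1 * r z.2 * r (z.1.1, z.2.2) * r (z.2.1, z.1.2) * mixedDiff f z

lemma weightedDiff_swapSnd (z) : weightedDiff f r (swapSnd z) = -weightedDiff f r z := by
  simp only [weightedDiff, mixedDiff, swapSnd]; ring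

lemma weightedDiff_swap (z) : weightedDiff f r z.swap = weightedDiff f r z := by
  simp only [weightedDiff, mixedDiff, Prod.swap]; ring

variable {f r}

lemma measurable_mixedDiff (hf : Measurable f) : Measurable (mixedDiff f) := by
  unfold mixedDiff; fun_prop

lemma measurable_weightedDiff (hf : Measurable f) (hr : Measurable r) :
    Measurable (weightedDiff f r) := by
  have := measurable_mixedDiff hf
  unfold weightedDiff; fun_prop

lemma abs_mixedDiff_le {M : ℝ} (hM : ∀ p, |f p| ≤ M) (z) : |mixedDiff f z| ≤ 4 * M := by
  have h1 := abs_le.1 (hM z.1)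
  have h2 := abs_le.1 (hM z.2)
  have h3 := abs_le.1 (hM (z.1.1, z.2.2))
  have h4 := abs_le.1 (hM (z.2.1, z.1.2))
  rw [mixedDiff, abs_le]
  constructor <;> linarith [h1.1, h1.2, h2.1, h2.2, h3.1, h3.2, h4.1, h4.2]

lemma abs_weightedDiff_le {M : ℝ} (hM : ∀ p, |f p| ≤ M) (h0 : ∀ p, 0 ≤ r p) (h1 : ∀ p, r p ≤ 1)
    (z) : |weightedDiff f r z| ≤ r z.1 * (4 * M) := by
  have hM0 : 0 ≤ 4 * M := (abs_nonneg _).trans (abs_mixedDiff_le hM z)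
  have e1 := h0 z.1
  have e2 := h0 z.2
  have e3 := h0 (z.1.1, z.2.2)
  have e4 := h0 (z.2.1, z.1.2)
  have hA : r z.1 * r z.2 * r (z.1.1, z.2.2) * r (z.2.1, z.1.2) ≤ r z.1 * 1 * 1 * 1 := by
    gcongr <;> exact h1 _
  rw [weightedDiff, abs_mul, abs_of_nonneg (by positivity)]
  calc _ ≤ (r z.1 * 1 * 1 * 1) * (4 * M) := by
        gcongr; exact abs_mixedDiff_le hM z
    _ = _ := by ring

/-- A perturbation direction with vanishing marginals, positively correlated with `f`. -/
def direction (f r : ℝ × ℝ → ℝ) (p : ℝ × ℝ) : ℝ := ∫ q, weightedDiff f r (p, q) ∂usq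

lemma measurable_direction (hf : Measurable f) (hr : Measurable r) :
    Measurable (direction f r) :=
  ((measurable_weightedDiff hf hr).stronglyMeasurable.integral_prod_right').measurable

variable {M : ℝ}

lemma abs_direction_le (hM : ∀ p, |f p| ≤ M) (h0 : ∀ p, 0 ≤ r p) (h1 : ∀ p, r p ≤ 1) (p) :
    |direction f r p| ≤ r p * (4 * M) := by
  rw [direction]
  simpa using norm_integral_le_of_norm_le_const (μ := usq) (f := fun q => weightedDiff f r (p, q))
    (ae_of_all _ fun q => by simpa using abs_weightedDiff_le hM h0 h1 (p, q))

lemma integrable_mul_weightedDiff (hf : Measurable f) (hr : Measurable r) (hM : ∀ p, |f p| ≤ M)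
    (h0 : ∀ p, 0 ≤ r p) (h1 : ∀ p, r p ≤ 1) {g : (ℝ × ℝ) × ℝ × ℝ → ℝ} (hg : Measurable g) {C : ℝ}
    (hC : ∀ z, |g z| ≤ C) :
    Integrable (fun z => g z * weightedDiff f r z) (usq.prod usq) := by
  refine Integrable.of_bound (C := C * (4 * M))
    (hg.mul (measurable_weightedDiff hf hr)).aestronglyMeasurable (ae_of_all _ fun z => ?_)
  have hM0 : 0 ≤ 4 * M := (abs_nonneg _).trans (abs_mixedDiff_le hM z)
  rw [Real.norm_eq_abs, abs_mul]
  have := abs_weightedDiff_le hM h0 h1 z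
  have h2 := h1 z.1
  gcongr
  · exact (abs_nonneg _).trans (hC z)
  · exact hC z
  · nlinarith

lemma integral_mul_direction (hf : Measurable f) (hr : Measurable r) (hM : ∀ p, |f p| ≤ M)
    (h0 : ∀ p, 0 ≤ r p) (h1 : ∀ p, r p ≤ 1) {g : ℝ × ℝ → ℝ} (hg : Measurable g) {C : ℝ}
    (hC : ∀ z, |g z| ≤ C) :
    ∫ p, g p * direction f r p ∂usq = ∫ z, g z.1 * weightedDiff f r z ∂(usq.prod usq) := by
  have hi : Integrable (fun z : (ℝ × ℝ) × ℝ × ℝ => g z.1 * weightedDiff f r z)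
      (usq.prod usq) :=
    integrable_mul_weightedDiff hf hr hM h0 h1 (hg.comp measurable_fst) fun z => hC z.1
  rw [integral_prod _ hi]
  simp only [direction, integral_const_mul]

lemma integral_comp_swapSnd {g : (ℝ × ℝ) × ℝ × ℝ → ℝ} (hg : Measurable g) :
    ∫ z, g (swapSnd z) ∂(usq.prod usq) = ∫ z, g z ∂(usq.prod usq) := by
  have h := measurePreserving_swapSnd
  conv_rhs => rw [← h.map_eq, integral_map h.measurable.aemeasurable hg.aestronglyMeasurable]

lemma integral_mul_direction_fst (hf : Measurable f) (hr : Measurable r) (hM : ∀ p, |f p| ≤ M)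
    (h0 : ∀ p, 0 ≤ r p) (h1 : ∀ p, r p ≤ 1) {g : ℝ → ℝ} (hg : Measurable g) {C : ℝ}
    (hC : ∀ z, |g z| ≤ C) : ∫ p, g p.1 * direction f r p ∂usq = 0 := by
  rw [integral_mul_direction hf hr hM h0 h1 (g := fun p => g p.1) (hg.comp measurable_fst)
    fun z => hC z.1]
  have hm : Measurable fun z : (ℝ × ℝ) × ℝ × ℝ => g z.1.1 * weightedDiff f r z :=
    (hg.comp (measurable_fst.comp measurable_fst)).mul (measurable_weightedDiff hf hr)
  have := integral_comp_swapSnd hm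
  simp only [weightedDiff_swapSnd, mul_neg, integral_neg] at this
  simp only [swapSnd] at this
  linarith

lemma integral_mul_direction_snd (hf : Measurable f) (hr : Measurable r) (hM : ∀ p, |f p| ≤ M)
    (h0 : ∀ p, 0 ≤ r p) (h1 : ∀ p, r p ≤ 1) {g : ℝ → ℝ} (hg : Measurable g) {C : ℝ}
    (hC : ∀ z, |g z| ≤ C) : ∫ p, g p.2 * direction f r p ∂usq = 0 := by
  rw [integral_mul_direction hf hr hM h0 h1 (g := fun p => g p.2) (hg.comp measurable_snd)
    fun z => hC z.2]
  have hm : Measurable fun z : (ℝ × ℝ) × ℝ × ℝ => g z.2.2 * weightedDiff f r z :=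
    (hg.comp (measurable_snd.comp measurable_snd)).mul (measurable_weightedDiff hf hr)
  have e1 := integral_comp_swapSnd hm
  have e2 := integral_prod_swap (μ := usq) (ν := usq) (fun z => g z.2.2 * weightedDiff f r z)
  simp only [weightedDiff_swapSnd, mul_neg, integral_neg] at e1
  simp only [weightedDiff_swap] at e2
  simp only [swapSnd] at e1
  simp only [Prod.swap] at e2
  linarith

lemma integral_mixedDiff_mul_weightedDiff (hf : Measurable f) (hr : Measurable r)
    (hM : ∀ p, |f p| ≤ M) (h0 : ∀ p, 0 ≤ r p) (h1 : ∀ p, r p ≤ 1) :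
    ∫ z, mixedDiff f z * weightedDiff f r z ∂(usq.prod usq) =
      4 * ∫ p, f p * direction f r p ∂usq := by
  rw [integral_mul_direction hf hr hM h0 h1 hf hM]
  have hW := measurable_weightedDiff hf hr
  have m1 : Measurable fun z : (ℝ × ℝ) × ℝ × ℝ => f z.1 := by fun_prop
  have m2 : Measurable fun z : (ℝ × ℝ) × ℝ × ℝ => f z.2 := by fun_prop
  have m3 : Measurable fun z : (ℝ × ℝ) × ℝ × ℝ => f (z.1.1, z.2.2) := by fun_prop
  have m4 : Measurable fun z : (ℝ × ℝ) × ℝ × ℝ => f (z.2.1, z.1.2) := by fun_prop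
  have i1 := integrable_mul_weightedDiff hf hr hM h0 h1 m1 fun z => hM _
  have i2 := integrable_mul_weightedDiff hf hr hM h0 h1 m2 fun z => hM _
  have i3 := integrable_mul_weightedDiff hf hr hM h0 h1 m3 fun z => hM _
  have i4 := integrable_mul_weightedDiff hf hr hM h0 h1 m4 fun z => hM _
  have i12 : Integrable (fun z => f z.1 * weightedDiff f r z + f z.2 * weightedDiff f r z)
    (usq.prod usq) := i1.add i2
  have i123 : Integrable (fun z => f z.1 * weightedDiff f r z + f z.2 * weightedDiff f r z -
    f (z.1.1, z.2.2) * weightedDiff f r z) (usq.prod usq) := i12.sub i3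
  have e2 := integral_prod_swap (μ := usq) (ν := usq) (fun z => f z.2 * weightedDiff f r z)
  have e3 := integral_comp_swapSnd (m3.mul hW)
  have e4 := integral_comp_swapSnd (m4.mul hW)
  simp only [weightedDiff_swap, Prod.snd_swap] at e2
  simp only [Pi.mul_apply, weightedDiff_swapSnd, mul_neg, integral_neg] at e3 e4
  simp only [swapSnd, Prod.mk.eta] at e3 e4
  have : ∀ z, mixedDiff f z * weightedDiff f r z = f z.1 * weightedDiff f r z +
      f z.2 * weightedDiff f r z - f (z.1.1, z.2.2) * weightedDiff f r z -
      f (z.2.1, z.1.2) * weightedDiff f r z := fun z => by rw [mixedDiff]; ring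
  simp only [this]
  rw [integral_sub i123 i4, integral_sub i12 i3, integral_add i1 i2]
  linarith

end kernel

variable {f : ℝ × ℝ → ℝ} {M : ℝ}

lemma IsOpt.exists_direction {ρ : ℝ × ℝ → ℝ} {t : ℝ} (hf : Continuous f) (hM0 : 0 < M)
    (hM : ∀ p, |f p| ≤ M) (hρ : IsOpt f t ρ)
    (hne : ∃ z ∈ unitSq ×ˢ unitSq, mixedDiff f z ≠ 0) :
    ∃ k : ℝ × ℝ → ℝ, Measurable k ∧ (∀ p, |k p| ≤ ρ p) ∧
      (∀ A, MeasurableSet A → ∫ p in Prod.fst ⁻¹' A, k p ∂usq = 0) ∧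
      (∀ A, MeasurableSet A → ∫ p in Prod.snd ⁻¹' A, k p ∂usq = 0) ∧
      0 < ∫ p, k p * f p ∂usq := by
  set r : ℝ × ℝ → ℝ := fun p => min (ρ p) 1 with hr
  have hrm : Measurable r := hρ.dens.meas.min measurable_const
  have h0 : ∀ p, 0 ≤ r p := fun p => le_min (hρ.dens.nonneg p) zero_le_one
  have h1 : ∀ p, r p ≤ 1 := fun p => min_le_right _ _
  have hfm := hf.measurable
  refine ⟨fun p => (4 * M)⁻¹ * direction f r p, (measurable_direction hfm hrm).const_mul _,
    fun p => ?_, fun A hA => ?_, fun A hA => ?_, ?_⟩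
  · rw [abs_mul, abs_of_pos (by positivity), inv_mul_le_iff₀ (by positivity), mul_comm (4 * M)]
    exact (abs_direction_le hM h0 h1 p).trans (by gcongr; exact min_le_left _ _)
  · rw [integral_const_mul, ← integral_indicator (measurable_fst hA)]
    have := integral_mul_direction_fst hfm hrm hM h0 h1
      (g := A.indicator fun _ => (1 : ℝ)) (measurable_const.indicator hA) (C := 1)
      fun z => by by_cases hz : z ∈ A <;> simp [hz]
    have e : ∀ p : ℝ × ℝ, A.indicator (fun _ => (1 : ℝ)) p.1 * direction f r p =
        (Prod.fst ⁻¹' A).indicator (direction f r) p := fun p => by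
      by_cases hz : p.1 ∈ A <;> simp [hz]
    simp only [e] at this
    rw [this, mul_zero]
  · rw [integral_const_mul, ← integral_indicator (measurable_snd hA)]
    have := integral_mul_direction_snd hfm hrm hM h0 h1
      (g := A.indicator fun _ => (1 : ℝ)) (measurable_const.indicator hA) (C := 1)
      fun z => by by_cases hz : z ∈ A <;> simp [hz]
    have e : ∀ p : ℝ × ℝ, A.indicator (fun _ => (1 : ℝ)) p.2 * direction f r p =
        (Prod.snd ⁻¹' A).indicator (direction f r) p := fun p => by
      by_cases hz : p.2 ∈ A <;> simp [hz]
    simp only [e] at this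
    rw [this, mul_zero]
  · have e : ∀ p, (4 * M)⁻¹ * direction f r p * f p = (4 * M)⁻¹ * (f p * direction f r p) :=
      fun p => by ring
    simp only [e]
    rw [integral_const_mul]
    refine mul_pos (by positivity) ?_
    have key := integral_mixedDiff_mul_weightedDiff hfm hrm hM h0 h1
    have hnn : ∀ z, 0 ≤ mixedDiff f z * weightedDiff f r z := fun z => by
      have e1 := h0 z.1
      have e2 := h0 z.2
      have e3 := h0 (z.1.1, z.2.2)
      have e4 := h0 (z.2.1, z.1.2)
      rw [weightedDiff, mul_left_comm, ← sq]
      positivity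
    suffices 0 < ∫ z, mixedDiff f z * weightedDiff f r z ∂(usq.prod usq) by linarith
    refine (integral_nonneg hnn).lt_of_ne fun hzero => ?_
    have hi := integrable_mul_weightedDiff hfm hrm hM h0 h1 (measurable_mixedDiff hfm)
      (abs_mixedDiff_le hM)
    have hae := (integral_eq_zero_iff_of_nonneg hnn hi).1 hzero.symm
    have hpos : ∀ᵐ p ∂usq, 0 < r p := by
      filter_upwards [hρ.ae_pos hfm hM] with p hp
      exact lt_min hp zero_lt_one
    have p1 : ∀ᵐ z ∂(usq.prod usq), 0 < r z.1 := Measure.quasiMeasurePreserving_fst.ae hpos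
    have p2 : ∀ᵐ z ∂(usq.prod usq), 0 < r z.2 := Measure.quasiMeasurePreserving_snd.ae hpos
    have p3 : ∀ᵐ z ∂(usq.prod usq), 0 < r (swapSnd z).1 :=
      measurePreserving_swapSnd.quasiMeasurePreserving.ae p1
    have p4 : ∀ᵐ z ∂(usq.prod usq), 0 < r (swapSnd z).2 :=
      measurePreserving_swapSnd.quasiMeasurePreserving.ae p2
    have hD : mixedDiff f =ᵐ[usq.prod usq] fun _ => 0 := by
      filter_upwards [hae, p1, p2, p3, p4] with z hz q1 q2 q3 q4
      simp only [Pi.zero_apply, weightedDiff, mul_eq_zero] at hz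
      simp only [swapSnd] at q3 q4
      rcases hz with h | (((h | h) | h) | h) | h
      · exact h
      · exact absurd h q1.ne'
      · exact absurd h q2.ne'
      · exact absurd h q3.ne'
      · exact absurd h q4.ne'
      · exact h
    have hvol : usq.prod usq = volume.restrict (unitSq ×ˢ unitSq) := by
      simp only [usq, unif01, unitSq, Measure.prod_restrict, Measure.volume_eq_prod]
    rw [hvol] at hD
    obtain ⟨z, hz, hz0⟩ := hne
    have hcont : Continuous (mixedDiff f) := by unfold mixedDiff; fun_prop
    refine hz0 (Measure.eqOn_of_ae_eq hD hcont.continuousOn continuousOn_const ?_ hz)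
    simp only [unitSq, interior_prod_eq, interior_Icc, closure_prod_eq,
      closure_Ioo (zero_ne_one' ℝ)]
    exact subset_rfl

lemma not_isOpt_of_lt {ρ : ℝ × ℝ → ℝ} {s t : ℝ} (hst : s < t) (hf : Continuous f) (hM0 : 0 < M)
    (hM : ∀ p, |f p| ≤ M) (hs : IsOpt f s ρ) (hne : ∃ z ∈ unitSq ×ˢ unitSq, mixedDiff f z ≠ 0) :
    ¬ IsOpt f t ρ := by
  intro ht
  obtain ⟨k, hk, hkρ, hk1, hk2, hK⟩ := hs.exists_direction hf hM0 hM hne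
  set K := ∫ p, k p * f p ∂usq
  have hρ := hs.dens
  have hki : Integrable k usq := hρ.int.mono' hk.aestronglyMeasurable (ae_of_all _ hkρ)
  have hkf : Integrable (fun p => k p * f p) usq :=
    hki.mul_bdd hf.measurable.aestronglyMeasurable (ae_of_all _ fun p => by simpa using hM p)
  have hρf := hρ.integrable_mul hf.measurable hM
  set ε := min 1 ((t - s) * K / 4) with hε
  have hε0 : 0 < ε := lt_min one_pos (by have := sub_pos.2 hst; positivity)
  have hε1 : ε ≤ 1 := min_le_left _ _
  have hεk : ∀ p, |ε * k p| ≤ ε * ρ p := fun p => by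
    rw [abs_mul, abs_of_pos hε0]; gcongr; exact hkρ p
  have hεk' : ∀ p, |ε * k p| ≤ ρ p := fun p => (hεk p).trans (by nlinarith [hρ.nonneg p])
  have hdens : ∀ c : ℝ, |c| = ε → IsDens (fun p => ρ p + c * k p) := fun c hc => by
    refine hρ.add_of_integral_eq_zero (hk.const_mul _) (hki.const_mul _) (fun p => ?_)
      (fun A hA => ?_) (fun A hA => ?_)
    · have := hεk' p
      rw [abs_mul, abs_of_pos hε0, ← hc, ← abs_mul] at this
      linarith [(abs_le.1 this).1]
    · rw [integral_const_mul, hk1 A hA, mul_zero]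
    · rw [integral_const_mul, hk2 A hA, mul_zero]
  have dp := hdens ε (abs_of_pos hε0)
  have dm := hdens (-ε) (by rw [abs_neg, abs_of_pos hε0])
  have hpt : ∀ p, (ρ p + ε * k p) * Real.log (ρ p + ε * k p) +
      (ρ p + -ε * k p) * Real.log (ρ p + -ε * k p) ≤
      2 * (ρ p * Real.log (ρ p)) + 2 * ε ^ 2 * ρ p := fun p => by
    have := mul_log_symm_le (hρ.nonneg p) hε1 (hεk p)
    rwa [sub_eq_add_neg, ← neg_mul] at this
  have hbi : Integrable (fun p => 2 * (ρ p * Real.log (ρ p)) + 2 * ε ^ 2 * ρ p) usq :=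
    (hs.int.const_mul _).add (hρ.int.const_mul _)
  have ip := integrable_mul_log_of_le dp.meas dp.nonneg (hbi.add (integrable_const (1 : ℝ)))
    fun p => by
      have h1 := hpt p
      have h2 := neg_one_le_mul_log (dm.nonneg p)
      simp only [Pi.add_apply]; linarith
  have im := integrable_mul_log_of_le dm.meas dm.nonneg (hbi.add (integrable_const (1 : ℝ)))
    fun p => by
      have h1 := hpt p
      have h2 := neg_one_le_mul_log (dp.nonneg p)
      simp only [Pi.add_apply]; linarith
  have hent : ent (fun p => ρ p + ε * k p) + ent (fun p => ρ p + -ε * k p) ≤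
      2 * ent ρ + 2 * ε ^ 2 := by
    have := integral_mono (ip.add im) hbi hpt
    rw [integral_add' ip im, integral_add (hs.int.const_mul _) (hρ.int.const_mul _),
      integral_const_mul, integral_const_mul, hρ.integral_eq_one, mul_one] at this
    exact this
  have hlin : ∀ c : ℝ, ∫ p, (ρ p + c * k p) * f p ∂usq = (∫ p, ρ p * f p ∂usq) + c * K := by
    intro c
    simp only [add_mul, mul_assoc]
    rw [integral_add hρf (hkf.const_mul c), integral_const_mul]
  have o1 := ht.le _ dp ip
  have o2 := hs.le _ dm im
  rw [hlin] at o1 o2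
  have h3 : (t - s) * K * ε ≤ 2 * ε * ε := by nlinarith
  have h4 := le_of_mul_le_mul_right h3 hε0
  have h5 : ε ≤ (t - s) * K / 4 := min_le_right _ _
  have h6 : 0 < (t - s) * K := mul_pos (sub_pos.2 hst) hK
  linarith

lemma IsOpt.strictMono {ρ σ : ℝ × ℝ → ℝ} {s t : ℝ} (hst : s < t) (hf : Continuous f)
    (hM0 : 0 < M) (hM : ∀ p, |f p| ≤ M) (hs : IsOpt f s ρ) (ht : IsOpt f t σ)
    (hne : ∃ z ∈ unitSq ×ˢ unitSq, mixedDiff f z ≠ 0) :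
    ∫ p, ρ p * f p ∂usq < ∫ p, σ p * f p ∂usq := by
  have hsq := IsOpt.sq_sub_le hf.measurable hM0 hM hs ht
  by_contra! hle
  have h1 : 0 < t - s := sub_pos.2 hst
  have heq : ∫ p, σ p * f p ∂usq = ∫ p, ρ p * f p ∂usq := by
    have h2 : (t - s) * ((∫ p, σ p * f p ∂usq) - ∫ p, ρ p * f p ∂usq) ≤ 0 :=
      mul_nonpos_of_nonneg_of_nonpos h1.le (by linarith)
    have h3 : 0 ≤ 4 * M ^ 2 := by positivity
    have h4 : ((∫ p, σ p * f p ∂usq) - ∫ p, ρ p * f p ∂usq) ^ 2 ≤ 0 := by nlinarith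
    nlinarith
  refine not_isOpt_of_lt hst hf hM0 hM hs hne ⟨hs.dens, hs.int, fun τ hτ hτi => ?_⟩
  have h2 := hs.le σ ht.dens ht.int
  have h3 := ht.le τ hτ hτi
  rw [heq] at h2 h3
  linarith

open scoped Nat in
lemma log_factorial_le (m : ℕ) :
    Real.log (m ! : ℝ) ≤ m * Real.log m - m + 1 + Real.log m := by
  induction m with
  | zero => simp
  | succ m ih =>
    rcases Nat.eq_zero_or_pos m with rfl | hm
    · simp
    have hm' : (0 : ℝ) < m := by exact_mod_cast hm
    have h1 : Real.log ((m + 1)! : ℝ) = Real.log (m + 1) + Real.log (m ! : ℝ) := by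
      rw [Nat.factorial_succ, Nat.cast_mul, Real.log_mul (by positivity) (by positivity)]
      push_cast; rfl
    have h2 : 1 ≤ (m + 1) * (Real.log (m + 1) - Real.log m) := by
      have := Real.one_sub_inv_le_log_of_pos (x := ((m : ℝ) + 1) / m) (by positivity)
      rw [Real.log_div (by positivity) hm'.ne', inv_div] at this
      have h3 : 1 - (m : ℝ) / (m + 1) = 1 / (m + 1) := by field_simp; ring
      rw [h3, div_le_iff₀ (by positivity)] at this
      linarith
    rw [h1]
    push_cast
    nlinarith

open scoped Nat in
lemma mul_log_le_log_factorial (n : ℕ) (hn : 0 < n) :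
    n * Real.log n ≤ Real.log (n ! : ℝ) + n := by
  have h := Real.pow_div_factorial_le_exp (x := (n : ℝ)) (by positivity) n
  have h2 := Real.log_le_log (by positivity) h
  rw [Real.log_exp, Real.log_div (by positivity) (by positivity), Real.log_pow] at h2
  linarith

section Gibbs

variable {ι : Type*} [Fintype ι]

/-- The weight of `i` under the Gibbs distribution with log-density `S`. -/
def gibbs (S : ι → ℝ) (i : ι) : ℝ := Real.exp (S i - Real.log (∑ j, Real.exp (S j)))

lemma gibbs_pos (S : ι → ℝ) (i : ι) : 0 < gibbs S i := Real.exp_pos _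

lemma gibbs_eq [Nonempty ι] (S : ι → ℝ) (i : ι) :
    gibbs S i = Real.exp (S i) / ∑ j, Real.exp (S j) := by
  rw [gibbs, Real.exp_sub, Real.exp_log (Finset.sum_pos (fun _ _ => Real.exp_pos _)
    Finset.univ_nonempty)]

lemma sum_gibbs [Nonempty ι] (S : ι → ℝ) : ∑ i, gibbs S i = 1 := by
  simp only [gibbs_eq, ← Finset.sum_div]
  exact div_self (Finset.sum_pos (fun _ _ => Real.exp_pos _) Finset.univ_nonempty).ne'

/-- The Gibbs variational inequality. -/
lemma log_sum_exp_le [Nonempty ι] (S R : ι → ℝ) (hR : ∀ i, 0 < R i) {C : ℝ}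
    (hC : ∑ i, R i ≤ C) :
    Real.log (∑ j, Real.exp (S j)) ≤ ∑ i, gibbs S i * (S i - Real.log (R i)) + Real.log C := by
  set Z := Real.log (∑ j, Real.exp (S j)) with hZ
  have hC0 : 0 < C := (Finset.sum_pos (fun i _ => hR i) Finset.univ_nonempty).trans_le hC
  have h : ∀ i, gibbs S i * (Z - (S i - Real.log (R i)) - Real.log C) ≤ R i / C - gibbs S i := by
    intro i
    have hg := gibbs_pos S i
    have h1 := Real.log_le_sub_one_of_pos (x := R i / C / gibbs S i)
      (by have := hR i; positivity)
    rw [Real.log_div (by have := hR i; positivity) hg.ne', Real.log_div (hR i).ne' hC0.ne',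
      gibbs, Real.log_exp, ← gibbs] at h1
    have h2 := mul_le_mul_of_nonneg_left h1 hg.le
    rw [mul_sub _ (R i / C / gibbs S i), mul_div_cancel₀ _ hg.ne'] at h2
    rw [← hZ] at h2
    linarith [show gibbs S i * (Z - (S i - Real.log (R i)) - Real.log C) =
      gibbs S i * (Real.log (R i) - Real.log C - (S i - Z)) by ring]
  have hs := Finset.sum_le_sum fun i (_ : i ∈ Finset.univ) => h i
  rw [Finset.sum_sub_distrib, ← Finset.sum_div, sum_gibbs] at hs
  have h3 : (∑ i, R i) / C ≤ 1 := (div_le_one hC0).2 hC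
  have h4 : ∑ i, gibbs S i * (Z - (S i - Real.log (R i)) - Real.log C) =
      Z - Real.log C - ∑ i, gibbs S i * (S i - Real.log (R i)) := by
    have : ∀ i, gibbs S i * (Z - (S i - Real.log (R i)) - Real.log C) =
      gibbs S i * (Z - Real.log C) - gibbs S i * (S i - Real.log (R i)) := fun i => by ring
    simp only [this, Finset.sum_sub_distrib, ← Finset.sum_mul, sum_gibbs, one_mul]
  linarith

end Gibbs

section Blocks

variable {α κ : Type*} [Fintype α] [DecidableEq κ]

/-- The size of the block of `β` indexed by `b`. -/
def blockCard (β : α → κ) (b : κ) : ℕ := Fintype.card {a // β a = b}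

lemma blockCard_pos (β : α → κ) (j : α) : 0 < blockCard β (β j) :=
  Fintype.card_pos_iff.2 ⟨⟨j, rfl⟩⟩

lemma sum_ite_block (β : α → κ) (b : κ) (c : ℝ) :
    ∑ j, (if β j = b then c else 0) = blockCard β b * c := by
  rw [← Finset.sum_filter, Finset.sum_const, blockCard, Fintype.card_subtype, nsmul_eq_mul]

variable [DecidableEq α]

/-- The probability that the permutation maps `i` to `j` under the Gibbs distribution. -/
def pairProb (S : Equiv.Perm α → ℝ) (i j : α) : ℝ := ∑ π, if π i = j then gibbs S π else 0

lemma sum_gibbs_mul (S : Equiv.Perm α → ℝ) (h : α → α → ℝ) :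
    ∑ π, gibbs S π * ∑ i, h i (π i) = ∑ i, ∑ j, pairProb S i j * h i j := by
  simp only [pairProb, Finset.mul_sum, Finset.sum_mul]
  rw [Finset.sum_comm]
  refine Finset.sum_congr rfl fun i _ => ?_
  rw [Finset.sum_comm]
  refine Finset.sum_congr rfl fun π _ => ?_
  simp [ite_mul]

lemma pairProb_pos (S : Equiv.Perm α → ℝ) (i j : α) : 0 < pairProb S i j := by
  refine Finset.sum_pos' (fun π _ => ?_) ⟨Equiv.swap i j, Finset.mem_univ _, ?_⟩
  · split_ifs
    exacts [(gibbs_pos S π).le, le_rfl]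
  · simp [gibbs_pos]

lemma sum_pairProb_right (S : Equiv.Perm α → ℝ) (i : α) : ∑ j, pairProb S i j = 1 := by
  simp only [pairProb]
  rw [Finset.sum_comm]
  simpa using sum_gibbs S

lemma sum_pairProb_left (S : Equiv.Perm α → ℝ) (j : α) : ∑ i, pairProb S i j = 1 := by
  simp only [pairProb]
  rw [Finset.sum_comm]
  simp only [← Equiv.eq_symm_apply]
  simpa using sum_gibbs S

/-- The probability that the permutation maps `i` into the block `b`. -/
def blockProb (S : Equiv.Perm α → ℝ) (β : α → κ) (i : α) (b : κ) : ℝ :=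
  ∑ j, if β j = b then pairProb S i j else 0

/-- The matrix `pairProb`, averaged over the blocks of `β` in the second variable. -/
def blockAvg (S : Equiv.Perm α → ℝ) (β : α → κ) (i j : α) : ℝ :=
  blockProb S β i (β j) / blockCard β (β j)

variable (S : Equiv.Perm α → ℝ) (β : α → κ)

lemma blockProb_nonneg (i : α) (b : κ) : 0 ≤ blockProb S β i b :=
  Finset.sum_nonneg fun j _ => by split_ifs; exacts [(pairProb_pos S i j).le, le_rfl]

lemma blockProb_pos (i j : α) : 0 < blockProb S β i (β j) := by
  refine Finset.sum_pos' (fun j' _ => ?_) ⟨j, Finset.mem_univ _, ?_⟩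
  · split_ifs
    exacts [(pairProb_pos S i j').le, le_rfl]
  · simp [pairProb_pos]

lemma blockAvg_pos (i j : α) : 0 < blockAvg S β i j :=
  div_pos (blockProb_pos S β i j) (by exact_mod_cast blockCard_pos β j)

lemma sum_blockAvg_left (j : α) : ∑ i, blockAvg S β i j = 1 := by
  have h0 : (blockCard β (β j) : ℝ) ≠ 0 := by exact_mod_cast (blockCard_pos β j).ne'
  simp only [blockAvg, ← Finset.sum_div]
  rw [div_eq_one_iff_eq h0]
  simp only [blockProb]
  rw [Finset.sum_comm]
  have e : ∀ j', (∑ i, if β j' = β j then pairProb S i j' else 0) =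
      if β j' = β j then 1 else 0 := fun j' => by
    split_ifs
    exacts [sum_pairProb_left S j', Finset.sum_const_zero]
  simp only [e]
  rw [sum_ite_block, mul_one]

lemma abs_sum_pairProb_sub_le (a : α → α → ℝ) {ω : ℝ}
    (hω : ∀ i j j', β j = β j' → |a i j - a i j'| ≤ ω) (i : α) :
    |∑ j, pairProb S i j * a i j - ∑ j, blockAvg S β i j * a i j| ≤ ω := by
  have hc : ∀ j, (0 : ℝ) < blockCard β (β j) := fun j => by exact_mod_cast blockCard_pos β j
  have e1 : ∑ j, pairProb S i j * a i j =
      ∑ j, ∑ j', if β j' = β j then pairProb S i j / blockCard β (β j) * a i j else 0 := by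
    refine Finset.sum_congr rfl fun j _ => ?_
    rw [sum_ite_block]
    have := (hc j).ne'
    field_simp
  have e2 : ∑ j, blockAvg S β i j * a i j =
      ∑ j, ∑ j', if β j' = β j then pairProb S i j / blockCard β (β j) * a i j' else 0 := by
    rw [Finset.sum_comm]
    refine Finset.sum_congr rfl fun j _ => ?_
    simp only [blockAvg, blockProb, Finset.sum_div, Finset.sum_mul]
    refine Finset.sum_congr rfl fun j' _ => ?_
    by_cases h : β j' = β j
    · simp [h]
    · simp [h, Ne.symm h]
  have e3 : ω = ∑ j, ∑ j', if β j' = β j then pairProb S i j / blockCard β (β j) * ω else 0 := by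
    conv_lhs => rw [← one_mul ω, ← sum_pairProb_right S i, Finset.sum_mul]
    refine Finset.sum_congr rfl fun j _ => ?_
    rw [sum_ite_block]
    have := (hc j).ne'
    field_simp
  rw [e1, e2, ← Finset.sum_sub_distrib]
  simp only [← Finset.sum_sub_distrib]
  refine (Finset.abs_sum_le_sum_abs _ _).trans ?_
  conv_rhs => rw [e3]
  refine Finset.sum_le_sum fun j _ => (Finset.abs_sum_le_sum_abs _ _).trans ?_
  refine Finset.sum_le_sum fun j' _ => ?_
  by_cases h : β j' = β j
  · simp only [h, if_true]
    have hp : 0 < pairProb S i j / blockCard β (β j) := div_pos (pairProb_pos S i j) (hc j)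
    rw [← mul_sub, abs_mul, abs_of_pos hp]
    gcongr
    exact hω i j j' h.symm
  · simp [h]

variable [Fintype κ]

lemma sum_blockProb (i : α) : ∑ b, blockProb S β i b = 1 := by
  simp only [blockProb]
  rw [Finset.sum_comm]
  simpa using sum_pairProb_right S i

lemma sum_pairProb_mul_comp (i : α) (h : κ → ℝ) :
    ∑ j, pairProb S i j * h (β j) = ∑ b, blockProb S β i b * h b := by
  simp only [blockProb, Finset.sum_mul]
  rw [Finset.sum_comm]
  simp [ite_mul]

lemma sum_blockAvg_mul_comp (i : α) (h : κ → ℝ) :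
    ∑ j, blockAvg S β i j * h (β j) = ∑ b, blockProb S β i b * h b := by
  have e : ∀ j, blockAvg S β i j * h (β j) =
      ∑ b, if β j = b then blockProb S β i b / blockCard β b * h b else 0 := fun j => by
    simp [blockAvg]
  simp only [e]
  rw [Finset.sum_comm]
  refine Finset.sum_congr rfl fun b _ => ?_
  rw [sum_ite_block]
  rcases Nat.eq_zero_or_pos (blockCard β b) with h0 | h0
  · have : blockProb S β i b = 0 := by
      refine Finset.sum_eq_zero fun j _ => ?_
      rw [if_neg]
      rintro rfl
      exact (blockCard_pos β j).ne' h0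
    simp [this]
  · have : (blockCard β b : ℝ) ≠ 0 := by exact_mod_cast h0.ne'
    field_simp

lemma sum_blockAvg_right (i : α) : ∑ j, blockAvg S β i j = 1 := by
  simpa [sum_blockProb] using sum_blockAvg_mul_comp S β i fun _ => 1

open scoped Nat in
lemma card_perm_comp_le (g : α → κ) :
    (Finset.univ.filter fun π : Equiv.Perm α => β ∘ π = g).card ≤ ∏ b, (blockCard β b)! := by
  rcases Finset.eq_empty_or_nonempty (Finset.univ.filter fun π : Equiv.Perm α => β ∘ π = g)
    with h | ⟨π₀, h₀⟩
  · simp [h]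
  rw [Finset.mem_filter_univ] at h₀
  have := DomMulAct.stabilizer_card β
  rw [Fintype.card_subtype] at this
  unfold blockCard
  rw [← this]
  refine Finset.card_le_card_of_injOn (fun π => π * π₀⁻¹) (fun π hπ => ?_)
    fun π _ π' _ h => mul_right_cancel h
  simp only [Finset.coe_filter, Finset.mem_univ, true_and, Set.mem_ofPred_eq] at hπ ⊢
  funext x
  have h1 := congrFun hπ (π₀⁻¹ x)
  have h2 := congrFun h₀ (π₀⁻¹ x)
  have h3 : π₀ (π₀⁻¹ x) = x := π₀.apply_symm_apply x
  simp only [Function.comp_apply, Equiv.Perm.coe_mul] at *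
  rw [h1, ← h2, h3]

open scoped Nat in
lemma sum_prod_block_le (p : α → κ → ℝ) (h0 : ∀ i b, 0 ≤ p i b)
    (h1 : ∀ i, ∑ b, p i b = 1) :
    ∑ π : Equiv.Perm α, ∏ i, p i (β (π i)) ≤ ∏ b, ((blockCard β b)! : ℝ) := by
  have e : ∑ π : Equiv.Perm α, ∏ i, p i (β (π i)) =
      ∑ g : α → κ, ((Finset.univ.filter fun π : Equiv.Perm α => β ∘ π = g).card : ℝ) *
        ∏ i, p i (g i) := by
    rw [← Finset.sum_fiberwise Finset.univ (fun π : Equiv.Perm α => β ∘ π)]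
    refine Finset.sum_congr rfl fun g _ => ?_
    rw [← nsmul_eq_mul, ← Finset.sum_const]
    refine Finset.sum_congr rfl fun π hπ => ?_
    rw [Finset.mem_filter_univ] at hπ
    rw [← hπ]; rfl
  rw [e]
  calc _ ≤ ∑ g : α → κ, (∏ b, ((blockCard β b)! : ℝ)) * ∏ i, p i (g i) := by
        refine Finset.sum_le_sum fun g _ => mul_le_mul_of_nonneg_right ?_
          (Finset.prod_nonneg fun i _ => h0 _ _)
        exact_mod_cast card_perm_comp_le β g
    _ = _ := by
        rw [← Finset.mul_sum]
        have := Finset.prod_univ_sum (fun _ : α => (Finset.univ : Finset κ)) p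
        rw [Fintype.piFinset_univ] at this
        rw [← this]
        simp [h1]

open scoped Nat in
lemma log_sum_exp_le_block (a : α → α → ℝ) (hS : ∀ π, S π = ∑ i, a i (π i)) :
    Real.log (∑ π, Real.exp (S π)) ≤ ∑ i, ∑ j, pairProb S i j * a i j -
      ∑ i, ∑ j, blockAvg S β i j * Real.log (blockAvg S β i j) +
      ∑ b, (Real.log ((blockCard β b)! : ℝ) - blockCard β b * Real.log (blockCard β b)) := by
  have h := log_sum_exp_le S (fun π => ∏ i, blockProb S β i (β (π i)))
    (fun π => Finset.prod_pos fun i _ => blockProb_pos S β i (π i))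
    (sum_prod_block_le β _ (blockProb_nonneg S β) (sum_blockProb S β))
  rw [Real.log_prod fun b _ => by positivity] at h
  have e1 : ∀ π : Equiv.Perm α, S π - Real.log (∏ i, blockProb S β i (β (π i))) =
      ∑ i, (a i (π i) - Real.log (blockProb S β i (β (π i)))) := fun π => by
    rw [Finset.sum_sub_distrib, hS π,
      Real.log_prod fun i _ => (blockProb_pos S β i (π i)).ne']
  simp only [e1] at h
  rw [sum_gibbs_mul S (fun i j => a i j - Real.log (blockProb S β i (β j)))] at h
  simp only [mul_sub, Finset.sum_sub_distrib] at h ⊢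
  have e2 : ∑ i, ∑ j, pairProb S i j * Real.log (blockProb S β i (β j)) =
      ∑ i, ∑ j, blockAvg S β i j * Real.log (blockAvg S β i j) +
      ∑ b, (blockCard β b : ℝ) * Real.log (blockCard β b) := by
    have e3 : ∑ b, (blockCard β b : ℝ) * Real.log (blockCard β b) =
        ∑ i, ∑ j, blockAvg S β i j * Real.log (blockCard β (β j)) := by
      rw [Finset.sum_comm]
      simp only [← Finset.sum_mul, sum_blockAvg_left, one_mul]
      rw [← Finset.sum_fiberwise Finset.univ β]
      refine Finset.sum_congr rfl fun b _ => ?_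
      rw [blockCard, Fintype.card_subtype, ← nsmul_eq_mul, ← Finset.sum_const]
      refine Finset.sum_congr rfl fun j hj => ?_
      rw [Finset.mem_filter_univ] at hj
      rw [hj, blockCard, Fintype.card_subtype]
    rw [e3, ← Finset.sum_add_distrib]
    refine Finset.sum_congr rfl fun i _ => ?_
    rw [sum_pairProb_mul_comp S β i fun b => Real.log (blockProb S β i b),
      ← sum_blockAvg_mul_comp, ← Finset.sum_add_distrib]
    refine Finset.sum_congr rfl fun j _ => ?_
    have hc : (blockCard β (β j) : ℝ) ≠ 0 := by exact_mod_cast (blockCard_pos β j).ne'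
    conv_rhs => rw [← mul_add, ← Real.log_mul (blockAvg_pos S β i j).ne' hc, blockAvg,
      div_mul_cancel₀ _ hc, ← blockAvg]
  rw [e2] at h
  linarith

end Blocks

section Cells

variable (n : ℕ) [NeZero n]

/-- The index of the cell of length `1 / n` containing `x`. -/
def cellIdx (x : ℝ) : Fin n :=
  ⟨min ⌊n * x⌋₊ (n - 1), (min_le_right _ _).trans_lt (Nat.sub_one_lt (NeZero.ne n))⟩

lemma measurable_cellIdx : Measurable (cellIdx n) := by
  have h : Measurable fun x : ℝ => ⌊n * x⌋₊ := Nat.measurable_floor.comp (measurable_const_mul _)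
  refine measurable_to_countable' fun i => ?_
  have : cellIdx n ⁻¹' {i} = (fun x : ℝ => ⌊n * x⌋₊) ⁻¹' {m | min m (n - 1) = i.1} := by
    ext x; simp [cellIdx, Fin.ext_iff]
  rw [this]
  exact h (Set.to_countable _).measurableSet

lemma cellIdx_bounds {x : ℝ} (hx : x ∈ Set.Icc (0 : ℝ) 1) :
    ((cellIdx n x).1 : ℝ) ≤ n * x ∧ n * x ≤ (cellIdx n x).1 + 1 := by
  have hn : (0 : ℝ) < n := by exact_mod_cast Nat.pos_of_ne_zero (NeZero.ne n)
  have hnx : (0 : ℝ) ≤ n * x := mul_nonneg hn.le hx.1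
  have h1 := Nat.floor_le hnx
  have h2 := Nat.lt_floor_add_one (n * x)
  constructor
  · refine le_trans ?_ h1
    exact_mod_cast min_le_left _ _
  · simp only [cellIdx]
    rcases min_choice ⌊n * x⌋₊ (n - 1) with h | h <;> rw [h]
    · exact h2.le
    · have : ((n - 1 : ℕ) : ℝ) + 1 = n := by
        exact_mod_cast Nat.sub_add_cancel (Nat.pos_of_ne_zero (NeZero.ne n))
      rw [this]
      nlinarith [hx.2]

lemma abs_sub_cellIdx_le {x : ℝ} (hx : x ∈ Set.Icc (0 : ℝ) 1) :
    |x - ((cellIdx n x).1 + 1 : ℝ) / n| ≤ 1 / n := by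
  have hn : (0 : ℝ) < n := by exact_mod_cast Nat.pos_of_ne_zero (NeZero.ne n)
  obtain ⟨h1, h2⟩ := cellIdx_bounds n hx
  have e : x - ((cellIdx n x).1 + 1 : ℝ) / n = (n * x - ((cellIdx n x).1 + 1)) / n := by
    field_simp
  rw [e, abs_div, abs_of_pos hn]
  gcongr
  rw [abs_le]
  constructor <;> linarith

lemma unif01_real_cellIdx_preimage (i : Fin n) :
    unif01.real (cellIdx n ⁻¹' {i}) = 1 / n := by
  have hn : (0 : ℝ) < n := by exact_mod_cast Nat.pos_of_ne_zero (NeZero.ne n)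
  have hi : (i.1 : ℝ) + 1 ≤ n := by exact_mod_cast i.2
  have h : (cellIdx n ⁻¹' {i} ∩ Set.Icc 0 1 : Set ℝ) =ᵐ[volume]
      (Set.Ico (i.1 / n) ((i.1 + 1) / n) : Set ℝ) := by
    have h1 : ∀ᵐ x : ℝ, x ≠ 1 := by simp [ae_iff]
    filter_upwards [h1] with x hx
    refine propext ⟨fun ⟨hxi, hx01⟩ => ?_, fun ⟨ha, hb⟩ => ?_⟩
    · have hlt : x < 1 := lt_of_le_of_ne hx01.2 hx
      have hnx : (0 : ℝ) ≤ n * x := mul_nonneg hn.le hx01.1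
      have hfl : ⌊n * x⌋₊ < n := (Nat.floor_lt hnx).2 (by nlinarith)
      have hfi : ⌊n * x⌋₊ = i.1 := by
        have := congrArg Fin.val (show cellIdx n x = i from hxi)
        simp only [cellIdx] at this
        omega
      rw [Nat.floor_eq_iff hnx] at hfi
      exact ⟨by rw [div_le_iff₀ hn]; linarith [hfi.1], by rw [lt_div_iff₀ hn]; linarith [hfi.2]⟩
    · rw [div_le_iff₀ hn] at ha
      rw [lt_div_iff₀ hn] at hb
      have h0 : (0 : ℝ) ≤ x * n := le_trans (by positivity) ha
      have hfi : ⌊n * x⌋₊ = i.1 :=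
        (Nat.floor_eq_iff (by linarith)).2 ⟨by linarith, by linarith⟩
      refine ⟨?_, nonneg_of_mul_nonneg_left h0 hn, ?_⟩
      · show cellIdx n x = i
        ext
        simp only [cellIdx]
        have := i.2
        omega
      · by_contra! hc
        nlinarith
  rw [measureReal_def, unif01,
    Measure.restrict_apply (measurable_cellIdx n (measurableSet_singleton i)),
    measure_congr h, Real.volume_Ico, ENNReal.toReal_ofReal]
  · ring
  · rw [← sub_div]; ring_nf; positivity

lemma integral_comp_cellIdx (F : Fin n → ℝ) :
    ∫ x, F (cellIdx n x) ∂unif01 = (1 / n) * ∑ i, F i := by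
  have hm := measurable_cellIdx n
  rw [← integral_map (φ := cellIdx n) hm.aemeasurable
    (measurable_of_finite F).aestronglyMeasurable]
  have : IsProbabilityMeasure (unif01.map (cellIdx n)) :=
    Measure.isProbabilityMeasure_map hm.aemeasurable
  rw [integral_fintype (Integrable.of_finite), Finset.mul_sum]
  refine Finset.sum_congr rfl fun i _ => ?_
  rw [measureReal_def, Measure.map_apply hm (measurableSet_singleton i), ← measureReal_def,
    unif01_real_cellIdx_preimage, smul_eq_mul]

lemma integrable_comp_cellIdx (F : Fin n → Fin n → ℝ) :
    Integrable (fun p : ℝ × ℝ => F (cellIdx n p.1) (cellIdx n p.2)) usq := by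
  have hm : Measurable fun p : ℝ × ℝ => (cellIdx n p.1, cellIdx n p.2) :=
    ((measurable_cellIdx n).comp measurable_fst).prodMk ((measurable_cellIdx n).comp measurable_snd)
  refine Integrable.of_bound (C := ∑ i, ∑ j, |F i j|)
    ((measurable_of_finite fun q : Fin n × Fin n => F q.1 q.2).comp hm).aestronglyMeasurable
    (ae_of_all _ fun p => ?_)
  exact (Finset.single_le_sum (f := fun j => |F (cellIdx n p.1) j|) (fun _ _ => abs_nonneg _)
    (Finset.mem_univ (cellIdx n p.2))).trans
    (Finset.single_le_sum (f := fun i => ∑ j, |F i j|)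
      (fun _ _ => Finset.sum_nonneg fun _ _ => abs_nonneg _) (Finset.mem_univ (cellIdx n p.1)))

lemma integral_comp_cellIdx_prod (F : Fin n → Fin n → ℝ) :
    ∫ p : ℝ × ℝ, F (cellIdx n p.1) (cellIdx n p.2) ∂usq = (1 / n) ^ 2 * ∑ i, ∑ j, F i j := by
  have hi := integrable_comp_cellIdx n F
  rw [usq] at hi ⊢
  rw [integral_prod _ hi]
  simp only [integral_comp_cellIdx n (F _)]
  rw [integral_comp_cellIdx n fun i => 1 / n * ∑ j, F i j, ← Finset.mul_sum]
  ring

variable {n}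

lemma isDens_stepDensity (W : Fin n → Fin n → ℝ) (h0 : ∀ i j, 0 ≤ W i j)
    (h1 : ∀ i, ∑ j, W i j = 1) (h2 : ∀ j, ∑ i, W i j = 1) :
    IsDens fun p => n * W (cellIdx n p.1) (cellIdx n p.2) := by
  have hn : (n : ℝ) ≠ 0 := by exact_mod_cast NeZero.ne n
  have hm : Measurable fun p : ℝ × ℝ => (cellIdx n p.1, cellIdx n p.2) :=
    ((measurable_cellIdx n).comp measurable_fst).prodMk ((measurable_cellIdx n).comp measurable_snd)
  have hi := integrable_comp_cellIdx n fun i j => n * W i j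
  refine ⟨(measurable_of_finite fun q : Fin n × Fin n => n * W q.1 q.2).comp hm,
    fun p => mul_nonneg (Nat.cast_nonneg n) (h0 _ _), hi, fun A hA => ?_, fun A hA => ?_⟩
  · rw [show (Prod.fst ⁻¹' A : Set (ℝ × ℝ)) = A ×ˢ Set.univ by ext; simp]
    rw [usq] at hi ⊢
    rw [setIntegral_prod _ hi.integrableOn]
    have e : ∀ x, ∫ y, n * W (cellIdx n x) (cellIdx n y) ∂unif01 = 1 := fun x => by
      rw [integral_comp_cellIdx n fun j => n * W (cellIdx n x) j,
        ← Finset.mul_sum, h1]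
      field_simp
    simp [e]
  · rw [show (Prod.snd ⁻¹' A : Set (ℝ × ℝ)) = Set.univ ×ˢ A by ext; simp]
    rw [usq] at hi ⊢
    have hi' := hi.integrableOn (s := Set.univ ×ˢ A)
    rw [IntegrableOn, ← Measure.prod_restrict, Measure.restrict_univ] at hi'
    rw [← Measure.prod_restrict, Measure.restrict_univ, integral_prod_symm _ hi']
    have e : ∀ y, ∫ x, n * W (cellIdx n x) (cellIdx n y) ∂unif01 = 1 := fun y => by
      rw [integral_comp_cellIdx n fun i => n * W i (cellIdx n y),
        ← Finset.mul_sum, h2]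
      field_simp
    simp [e]

end Cells

lemma ae_mem_unitSq : ∀ᵐ p ∂usq, p ∈ unitSq := by
  have : usq = volume.restrict unitSq := by
    simp only [usq, unif01, unitSq, Measure.prod_restrict, Measure.volume_eq_prod]
  rw [this]
  exact ae_restrict_mem (measurableSet_Icc.prod measurableSet_Icc)

open scoped Nat in
/-- The normalized log partition function, relative to the uniform distribution. -/
def pressure (f : ℝ × ℝ → ℝ) (n : ℕ) (t : ℝ) : ℝ := (Zn f t n - Real.log (n ! : ℝ)) / n

section Upper

variable {f : ℝ × ℝ → ℝ} {M η δ t : ℝ} {n : ℕ}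

lemma sum_blockCard {α κ : Type*} [Fintype α] [Fintype κ] [DecidableEq κ] (β : α → κ) :
    ∑ b, (blockCard β b : ℝ) = Fintype.card α := by
  have h : ∀ b, (blockCard β b : ℝ) = ∑ j, if β j = b then (1 : ℝ) else 0 := fun b => by
    rw [sum_ite_block, mul_one]
  simp only [h]
  rw [Finset.sum_comm]
  simp

open scoped Nat in
lemma sum_log_factorial_blockCard_le {k : ℕ} (β : Fin n → Fin k) :
    ∑ b, (Real.log ((blockCard β b)! : ℝ) - blockCard β b * Real.log (blockCard β b)) ≤
      k * (1 + Real.log n) - n := by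
  have h : ∀ b, Real.log ((blockCard β b)! : ℝ) - blockCard β b * Real.log (blockCard β b) ≤
      1 + Real.log n - blockCard β b := fun b => by
    have h1 := log_factorial_le (blockCard β b)
    have h2 : Real.log (blockCard β b) ≤ Real.log n := by
      rcases Nat.eq_zero_or_pos (blockCard β b) with h | h
      · simpa [h] using Real.log_natCast_nonneg n
      · refine Real.log_le_log (by exact_mod_cast h) ?_
        have := Fintype.card_subtype_le fun a : Fin n => β a = b
        rw [Fintype.card_fin] at this
        exact_mod_cast this
    linarith
  refine (Finset.sum_le_sum fun b _ => h b).trans_eq ?_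
  rw [Finset.sum_sub_distrib, sum_blockCard]
  simp [mul_add]

variable [NeZero n]

lemma abs_integral_stepDensity_sub_le (hf : Measurable f) (hM : ∀ p, |f p| ≤ M)
    (hη : ∀ p q : ℝ × ℝ, |p.1 - q.1| ≤ δ → |p.2 - q.2| ≤ δ → |f p - f q| ≤ η)
    (hn : 1 / (n : ℝ) ≤ δ) {W : Fin n → Fin n → ℝ} (h0 : ∀ i j, 0 ≤ W i j)
    (h1 : ∀ i, ∑ j, W i j = 1) (h2 : ∀ j, ∑ i, W i j = 1) :
    |(∫ p, n * W (cellIdx n p.1) (cellIdx n p.2) * f p ∂usq) -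
      1 / n * ∑ i, ∑ j, W i j * f ((i.1 + 1 : ℝ) / n, (j.1 + 1 : ℝ) / n)| ≤ η := by
  have hn0 : (n : ℝ) ≠ 0 := by exact_mod_cast NeZero.ne n
  have hd := isDens_stepDensity W h0 h1 h2
  have hW := integrable_comp_cellIdx n fun i j =>
    n * W i j * f ((i.1 + 1 : ℝ) / n, (j.1 + 1 : ℝ) / n)
  have e : 1 / n * ∑ i, ∑ j, W i j * f ((i.1 + 1 : ℝ) / n, (j.1 + 1 : ℝ) / n) =
      ∫ p : ℝ × ℝ, n * W (cellIdx n p.1) (cellIdx n p.2) *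
        f (((cellIdx n p.1).1 + 1 : ℝ) / n, ((cellIdx n p.2).1 + 1 : ℝ) / n) ∂usq := by
    rw [integral_comp_cellIdx_prod n fun i j =>
      n * W i j * f ((i.1 + 1 : ℝ) / n, (j.1 + 1 : ℝ) / n)]
    simp only [mul_assoc, ← Finset.mul_sum]
    field_simp
  rw [e, ← integral_sub (hd.integrable_mul hf hM) hW]
  have hb := norm_integral_le_of_norm_le (μ := usq) (hd.int.mul_const η)
    (f := fun p => n * W (cellIdx n p.1) (cellIdx n p.2) * f p -
      n * W (cellIdx n p.1) (cellIdx n p.2) *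
        f (((cellIdx n p.1).1 + 1 : ℝ) / n, ((cellIdx n p.2).1 + 1 : ℝ) / n)) (by
    filter_upwards [ae_mem_unitSq] with p hp
    rw [← mul_sub, norm_mul, Real.norm_of_nonneg (hd.nonneg p), Real.norm_eq_abs]
    refine mul_le_mul_of_nonneg_left (hη _ _ ?_ ?_) (hd.nonneg p)
    · exact (abs_sub_cellIdx_le n hp.1).trans hn
    · exact (abs_sub_cellIdx_le n hp.2).trans hn)
  rwa [integral_mul_const, hd.integral_eq_one, one_mul] at hb

lemma ent_stepDensity {W : Fin n → Fin n → ℝ} (h0 : ∀ i j, 0 < W i j)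
    (h1 : ∀ i, ∑ j, W i j = 1) :
    ent (fun p => n * W (cellIdx n p.1) (cellIdx n p.2)) =
      Real.log n + 1 / n * ∑ i, ∑ j, W i j * Real.log (W i j) := by
  have hn0 : (n : ℝ) ≠ 0 := by exact_mod_cast NeZero.ne n
  rw [ent, integral_comp_cellIdx_prod n fun i j => n * W i j * Real.log (n * W i j)]
  have e : ∀ i j, n * W i j * Real.log (n * W i j) =
      n * (W i j * Real.log n + W i j * Real.log (W i j)) := fun i j => by
    rw [Real.log_mul hn0 (h0 i j).ne']; ring
  simp only [e, ← Finset.mul_sum, Finset.sum_add_distrib, ← Finset.sum_mul, h1]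
  simp
  field_simp

lemma pressure_le {ρ : ℝ × ℝ → ℝ} (hρ : IsOpt f t ρ) (hf : Measurable f) (hM : ∀ p, |f p| ≤ M)
    (hη : ∀ p q : ℝ × ℝ, |p.1 - q.1| ≤ δ → |p.2 - q.2| ≤ δ → |f p - f q| ≤ η)
    {k : ℕ} (hk : 0 < k) (hkδ : 1 / (k : ℝ) ≤ δ) (hn : 1 / (n : ℝ) ≤ δ) :
    pressure f n t ≤ t * (∫ p, ρ p * f p ∂usq) - ent ρ + 2 * |t| * η +
      k * (1 + Real.log n) / n := by
  have hn1 : 0 < n := Nat.pos_of_ne_zero (NeZero.ne n)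
  have hn0 : (0 : ℝ) < n := by exact_mod_cast hn1
  have hk0 : (0 : ℝ) < k := by exact_mod_cast hk
  set β : Fin n → Fin k := fun j =>
    ⟨j.1 * k / n, by rw [Nat.div_lt_iff_lt_mul hn1]; nlinarith [j.2]⟩ with hβ
  set S : Equiv.Perm (Fin n) → ℝ := fun π => t * permStat f n π with hS
  set a : Fin n → Fin n → ℝ := fun i j => f ((i.1 + 1 : ℝ) / n, (j.1 + 1 : ℝ) / n) with ha
  set W := blockAvg S β
  have h0 : ∀ i j, 0 < W i j := blockAvg_pos S β
  have h1 : ∀ i, ∑ j, W i j = 1 := sum_blockAvg_right S β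
  have h2 : ∀ j, ∑ i, W i j = 1 := sum_blockAvg_left S β
  have hZ := log_sum_exp_le_block S β (fun i j => t * a i j) fun π => by
    rw [hS, ← Finset.mul_sum]; rfl
  have hF := sum_log_factorial_blockCard_le β
  have hN := mul_log_le_log_factorial n hn1
  have hδ : 0 < δ := lt_of_lt_of_le (by positivity) hkδ
  have hmod : ∀ i j j', β j = β j' → |a i j - a i j'| ≤ η := fun i j j' h => by
    refine hη _ _ (by simpa using hδ.le) (le_trans ?_ hkδ)
    have hb : j.1 * k / n = j'.1 * k / n := congrArg Fin.val h
    simp only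
    rw [← sub_div, abs_div, abs_of_pos hn0, div_le_div_iff₀ hn0 hk0, one_mul]
    have e1 := Nat.div_add_mod (j.1 * k) n
    have e2 := Nat.div_add_mod (j'.1 * k) n
    have e3 := Nat.mod_lt (j.1 * k) hn1
    have e4 := Nat.mod_lt (j'.1 * k) hn1
    rw [hb] at e1
    have e5 : j.1 * k ≤ j'.1 * k + n := by omega
    have e6 : j'.1 * k ≤ j.1 * k + n := by omega
    have e5' : (j.1 : ℝ) * k ≤ j'.1 * k + n := by exact_mod_cast e5
    have e6' : (j'.1 : ℝ) * k ≤ j.1 * k + n := by exact_mod_cast e6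
    rw [← le_div_iff₀ hk0, abs_le, ← neg_div, div_le_iff₀ hk0, le_div_iff₀ hk0]
    constructor <;> nlinarith
  have hPW : |∑ i, ∑ j, pairProb S i j * a i j - ∑ i, ∑ j, W i j * a i j| ≤ n * η := by
    rw [← Finset.sum_sub_distrib]
    refine (Finset.abs_sum_le_sum_abs _ _).trans ?_
    refine (Finset.sum_le_sum fun i _ => abs_sum_pairProb_sub_le S β a hmod i).trans_eq ?_
    simp
  have hI := abs_integral_stepDensity_sub_le hf hM hη hn (fun i j => (h0 i j).le) h1 h2
  have hE := ent_stepDensity h0 h1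
  have hopt := hρ.le _ (isDens_stepDensity W (fun i j => (h0 i j).le) h1 h2)
    (integrable_comp_cellIdx n fun i j => n * W i j * Real.log (n * W i j))
  rw [hE] at hopt
  set I := ∫ p, n * W (cellIdx n p.1) (cellIdx n p.2) * f p ∂usq
  set A := ∑ i, ∑ j, W i j * a i j
  set B := ∑ i, ∑ j, pairProb S i j * a i j
  set L := ∑ i, ∑ j, W i j * Real.log (W i j)
  have eB : ∑ i, ∑ j, pairProb S i j * (t * a i j) = t * B := by
    simp only [B, Finset.mul_sum]
    exact Finset.sum_congr rfl fun i _ => Finset.sum_congr rfl fun j _ => by ring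
  rw [eB] at hZ
  have hZ' : Zn f t n ≤ t * B - L + (k * (1 + Real.log n) - n) := by
    refine le_trans hZ ?_
    linarith
  have hB : t * B ≤ t * A + |t| * (n * η) := by
    have := mul_le_mul_of_nonneg_left hPW (abs_nonneg t)
    rw [← abs_mul] at this
    linarith [le_abs_self (t * (B - A)), mul_sub t B A]
  have hA : t * (1 / n * A) ≤ t * I + |t| * η := by
    have := mul_le_mul_of_nonneg_left hI (abs_nonneg t)
    rw [← abs_mul] at this
    linarith [neg_abs_le (t * (I - 1 / n * A)), mul_sub t I (1 / n * A)]
  have hA' : t * A ≤ n * (t * I + |t| * η) := by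
    have := mul_le_mul_of_nonneg_left hA hn0.le
    rwa [show n * (t * (1 / n * A)) = t * A by field_simp] at this
  have hopt' : n * (t * I - Real.log n) - L ≤ n * (t * (∫ p, ρ p * f p ∂usq) - ent ρ) := by
    have := mul_le_mul_of_nonneg_left hopt hn0.le
    rwa [show n * (t * I - (Real.log n + 1 / n * L)) = n * (t * I - Real.log n) - L by
      field_simp; ring] at this
  rw [pressure, div_le_iff₀ hn0]
  have : (t * (∫ p, ρ p * f p ∂usq) - ent ρ + 2 * |t| * η + k * (1 + Real.log n) / n) * n =
      n * (t * (∫ p, ρ p * f p ∂usq) - ent ρ) + 2 * |t| * η * n + k * (1 + Real.log n) := by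
    field_simp
  rw [this]
  nlinarith

end Upper

lemma UniformContinuous.exists_modulus {f : ℝ × ℝ → ℝ} (hf : UniformContinuous f) {η : ℝ}
    (hη : 0 < η) : ∃ δ > 0, ∀ p q : ℝ × ℝ, |p.1 - q.1| ≤ δ → |p.2 - q.2| ≤ δ →
      |f p - f q| ≤ η := by
  obtain ⟨δ, hδ, h⟩ := Metric.uniformContinuous_iff.1 hf η hη
  refine ⟨δ / 2, by positivity, fun p q h1 h2 => (h (a := p) (b := q) ?_).le⟩
  rw [Prod.dist_eq, Real.dist_eq, Real.dist_eq]
  exact (max_le h1 h2).trans_lt (by linarith)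

lemma eventually_pressure_le {f ρ : ℝ × ℝ → ℝ} {M t : ℝ} (hf : UniformContinuous f)
    (hM : ∀ p, |f p| ≤ M) (hρ : IsOpt f t ρ) {ε : ℝ} (hε : 0 < ε) :
    ∀ᶠ n in atTop, pressure f n t ≤ t * (∫ p, ρ p * f p ∂usq) - ent ρ + ε := by
  set η := ε / (4 * (|t| + 1)) with hη
  have ht : 0 < |t| + 1 := by positivity
  obtain ⟨δ, hδ, hmod⟩ := hf.exists_modulus (η := η) (by positivity)
  obtain ⟨k, hk⟩ := exists_nat_one_div_lt hδ
  have hlog : Tendsto (fun n : ℕ => ((k + 1 : ℕ) : ℝ) * (1 + Real.log n) / n) atTop (𝓝 0) := by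
    have h1 := (Real.isLittleO_log_id_atTop.tendsto_div_nhds_zero).comp
      (tendsto_natCast_atTop_atTop (R := ℝ))
    have h2 := (h1.add (tendsto_one_div_atTop_nhds_zero_nat (𝕜 := ℝ))).const_mul ((k + 1 : ℕ) : ℝ)
    simp only [add_zero, mul_zero] at h2
    refine h2.congr fun n => ?_
    simp only [Function.comp_apply, id]
    ring
  have hnδ := (tendsto_one_div_atTop_nhds_zero_nat (𝕜 := ℝ)).eventually (gt_mem_nhds hδ)
  filter_upwards [hlog.eventually (gt_mem_nhds (half_pos hε)), hnδ, eventually_gt_atTop 0]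
    with n h1 h2 h3
  have : NeZero n := ⟨h3.ne'⟩
  have h := pressure_le (n := n) hρ hf.continuous.measurable hM hmod (k := k + 1) k.succ_pos
    (by push_cast; exact hk.le) h2.le
  have h4 : 2 * |t| * η ≤ ε / 2 := by
    have : (|t| + 1) * η = ε / 4 := by rw [hη]; field_simp
    have : 0 < η := by positivity
    nlinarith
  linarith

section Product

variable {ι Ω : Type*} [Fintype ι] [MeasurableSpace Ω] (N : Measure Ω) [IsProbabilityMeasure N]

lemma pi_withDensity {r : Ω → ℝ≥0∞} (hr : Measurable r) [SigmaFinite (N.withDensity r)] :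
    Measure.pi (fun _ : ι => N.withDensity r) =
      (Measure.pi fun _ : ι => N).withDensity fun z => ∏ i, r (z i) := by
  refine Measure.pi_eq fun s hs => ?_
  rw [withDensity_apply _ (MeasurableSet.univ_pi hs),
    ← lintegral_indicator (MeasurableSet.univ_pi hs)]
  have e : ∀ z : ι → Ω, (Set.univ.pi s).indicator (fun z => ∏ i, r (z i)) z =
      ∏ i, (s i).indicator r (z i) := fun z => by
    by_cases hz : z ∈ Set.univ.pi s
    · rw [Set.indicator_of_mem hz]
      exact Finset.prod_congr rfl fun i _ => (Set.indicator_of_mem (hz i trivial) _).symm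
    · rw [Set.indicator_of_notMem hz]
      simp only [Set.mem_pi, Set.mem_univ, true_imp_iff, not_forall] at hz
      obtain ⟨i, hi⟩ := hz
      exact (Finset.prod_eq_zero (Finset.mem_univ i) (Set.indicator_of_notMem hi _)).symm
  simp only [e]
  have hm : ∀ i, Measurable ((s i).indicator r) := fun i => hr.indicator (hs i)
  rw [ProbabilityTheory.lintegral_prod_eq_prod_lintegral_of_indepFun Finset.univ
    (fun i (z : ι → Ω) => (s i).indicator r (z i))
    (ProbabilityTheory.iIndepFun_pi (μ := fun _ : ι => N) fun i => (hm i).aemeasurable)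
    fun i => (hm i).comp (measurable_pi_apply i)]
  refine Finset.prod_congr rfl fun i _ => ?_
  rw [withDensity_apply _ (hs i), ← lintegral_indicator (hs i)]
  exact (measurePreserving_eval (fun _ : ι => N) i).lintegral_comp (hm i)

lemma ofReal_exp_integral_le {Ω : Type*} [MeasurableSpace Ω] {P : Measure Ω}
    [IsProbabilityMeasure P] {G : Ω → ℝ} (hG : Integrable G P) :
    ENNReal.ofReal (Real.exp (∫ z, G z ∂P)) ≤ ∫⁻ z, ENNReal.ofReal (Real.exp (G z)) ∂P := by
  by_cases h : ∫⁻ z, ENNReal.ofReal (Real.exp (G z)) ∂P = ⊤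
  · rw [h]; exact le_top
  have hi : Integrable (fun z => Real.exp (G z)) P :=
    (lintegral_ofReal_ne_top_iff_integrable
      (Real.continuous_exp.comp_aestronglyMeasurable hG.aestronglyMeasurable)
      (ae_of_all _ fun z => (Real.exp_pos _).le)).1 h
  rw [← ofReal_integral_eq_lintegral_ofReal hi (ae_of_all _ fun z => (Real.exp_pos _).le)]
  exact ENNReal.ofReal_le_ofReal (convexOn_exp.map_integral_le Real.continuous_exp.continuousOn
    isClosed_univ (ae_of_all _ fun _ => trivial) hG hi)

lemma ofReal_exp_sub_entropy_le {ρ : Ω → ℝ} (hρ : Measurable ρ) (h0 : ∀ p, 0 ≤ ρ p)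
    [IsProbabilityMeasure (N.withDensity fun p => ENNReal.ofReal (ρ p))]
    (hi : Integrable (fun p => Real.log (ρ p)) (N.withDensity fun p => ENNReal.ofReal (ρ p)))
    {F : (ι → Ω) → ℝ} (hF : Measurable F) {C : ℝ} (hC : ∀ z, |F z| ≤ C) :
    ENNReal.ofReal (Real.exp
      ((∫ z, F z ∂(Measure.pi fun _ : ι => N.withDensity fun p => ENNReal.ofReal (ρ p))) -
        Fintype.card ι * ∫ p, Real.log (ρ p) ∂(N.withDensity fun p => ENNReal.ofReal (ρ p)))) ≤
      ∫⁻ z, ENNReal.ofReal (Real.exp (F z)) ∂(Measure.pi fun _ : ι => N) := by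
  set P := N.withDensity fun p => ENNReal.ofReal (ρ p) with hP
  have hrm : Measurable fun p => ENNReal.ofReal (ρ p) := hρ.ennreal_ofReal
  have hFi : Integrable F (Measure.pi fun _ : ι => P) :=
    Integrable.of_bound hF.aestronglyMeasurable C (ae_of_all _ hC)
  have hLi : ∀ i, Integrable (fun z : ι → Ω => Real.log (ρ (z i))) (Measure.pi fun _ : ι => P) :=
    fun i => (measurePreserving_eval (fun _ : ι => P) i).integrable_comp_of_integrable hi
  have hL : ∀ i, ∫ z : ι → Ω, Real.log (ρ (z i)) ∂(Measure.pi fun _ : ι => P) =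
      ∫ p, Real.log (ρ p) ∂P := fun i => by
    have h := measurePreserving_eval (fun _ : ι => P) i
    have hm : Measurable fun p => Real.log (ρ p) := Real.measurable_log.comp hρ
    conv_rhs => rw [← h.map_eq, integral_map h.measurable.aemeasurable hm.aestronglyMeasurable]
  have hG : Integrable (fun z : ι → Ω => F z - ∑ i, Real.log (ρ (z i)))
      (Measure.pi fun _ : ι => P) := hFi.sub (integrable_finsetSum _ fun i _ => hLi i)
  have hE : ∫ z : ι → Ω, (F z - ∑ i, Real.log (ρ (z i))) ∂(Measure.pi fun _ : ι => P) =
      (∫ z, F z ∂(Measure.pi fun _ : ι => P)) - Fintype.card ι * ∫ p, Real.log (ρ p) ∂P := by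
    rw [integral_sub hFi (integrable_finsetSum _ fun i _ => hLi i),
      integral_finsetSum _ fun i _ => hLi i]
    simp [hL]
  rw [← hE]
  refine (ofReal_exp_integral_le hG).trans ?_
  rw [hP, pi_withDensity N hrm]
  have hDm : Measurable fun z : ι → Ω => ∏ i, ENNReal.ofReal (ρ (z i)) :=
    Finset.measurable_prod _ fun i _ => hrm.comp (measurable_pi_apply i)
  have hGm : Measurable fun z : ι → Ω => F z - ∑ i, Real.log (ρ (z i)) :=
    hF.sub (Finset.measurable_sum _ fun i _ =>
      Real.measurable_log.comp (hρ.comp (measurable_pi_apply i)))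
  have hEm : Measurable fun z : ι → Ω =>
    ENNReal.ofReal (Real.exp (F z - ∑ i, Real.log (ρ (z i)))) :=
    (Real.measurable_exp.comp hGm).ennreal_ofReal
  rw [lintegral_withDensity_eq_lintegral_mul _ hDm hEm]
  refine lintegral_mono fun z => ?_
  simp only [Pi.mul_apply]
  rw [← ENNReal.ofReal_prod_of_nonneg fun i _ => h0 _,
    ← ENNReal.ofReal_mul (Finset.prod_nonneg fun i _ => h0 _)]
  refine ENNReal.ofReal_le_ofReal ?_
  by_cases hz : ∀ i, 0 < ρ (z i)
  · rw [← Real.log_prod fun i _ => (hz i).ne', Real.exp_sub,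
      Real.exp_log (Finset.prod_pos fun i _ => hz i),
      mul_div_cancel₀ _ (Finset.prod_pos fun i _ => hz i).ne']
  · push Not at hz
    obtain ⟨i, hzi⟩ := hz
    rw [Finset.prod_eq_zero (Finset.mem_univ i) (le_antisymm hzi (h0 _)), zero_mul]
    exact (Real.exp_pos _).le

end Product

section Rank

variable {n : ℕ}

/-- The rank of `x i` among the values of `x`. -/
def rank (x : Fin n → ℝ) (i : Fin n) : ℝ := ∑ j, if x j ≤ x i then 1 else 0

lemma rank_eq_card (x : Fin n → ℝ) (i : Fin n) :
    rank x i = ((Finset.univ.filter fun j => x j ≤ x i).card : ℝ) := by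
  simp [rank]

lemma measurable_rank (i : Fin n) : Measurable fun x : Fin n → ℝ => rank x i :=
  Finset.measurable_sum _ fun j _ => Measurable.ite
    (measurableSet_le (measurable_pi_apply j) (measurable_pi_apply i)) measurable_const
    measurable_const

lemma rank_comp (x : Fin n → ℝ) (σ : Equiv.Perm (Fin n)) (i : Fin n) :
    rank (x ∘ σ) i = rank x (σ i) :=
  Equiv.sum_comp σ fun j => if x j ≤ x (σ i) then (1 : ℝ) else 0

lemma exists_perm_rank {x : Fin n → ℝ} (hx : Function.Injective x) :
    ∃ σ : Equiv.Perm (Fin n), ∀ i, rank x i = (σ i).1 + 1 := by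
  set s : Fin n → Finset (Fin n) := fun i => Finset.univ.filter fun j => x j ≤ x i with hs
  have hself : ∀ i, i ∈ s i := fun i => by simp [hs]
  have hpos : ∀ i, 0 < (s i).card := fun i => Finset.card_pos.2 ⟨i, hself i⟩
  have hle : ∀ i, (s i).card ≤ n := fun i => by simpa using Finset.card_le_univ (s i)
  have hlt : ∀ i j, x i < x j → (s i).card < (s j).card := fun i j h => by
    refine Finset.card_lt_card (Finset.ssubset_iff_subset_ne.2 ⟨fun k hk => ?_, fun he => ?_⟩)
    · simp only [hs, Finset.mem_filter_univ] at hk ⊢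
      exact hk.trans h.le
    · have := hself j
      rw [← he] at this
      simp only [hs, Finset.mem_filter_univ] at this
      exact absurd this (not_le.2 h)
  set τ : Fin n → Fin n := fun i => ⟨(s i).card - 1, by have := hpos i; have := hle i; omega⟩
    with hτ
  have hinj : Function.Injective τ := fun i j h => by
    have h1 : (s i).card - 1 = (s j).card - 1 := congrArg Fin.val h
    have h2 := hpos i
    have h3 := hpos j
    rcases lt_trichotomy (x i) (x j) with h4 | h4 | h4
    · have := hlt i j h4; omega
    · exact hx h4
    · have := hlt j i h4; omega
  refine ⟨Equiv.ofBijective τ (Finite.injective_iff_bijective.1 hinj), fun i => ?_⟩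
  rw [rank_eq_card]
  have := hpos i
  simp only [Equiv.ofBijective_apply, hτ]
  have h : (s i).card = (s i).card - 1 + 1 := by omega
  exact_mod_cast h

/-- The permutation statistic evaluated on the ranks of two vectors. -/
def rankStat (f : ℝ × ℝ → ℝ) (x y : Fin n → ℝ) : ℝ := ∑ i, f (rank x i / n, rank y i / n)

lemma sum_exp_rankStat (f : ℝ × ℝ → ℝ) (t : ℝ) {x y : Fin n → ℝ} (hx : Function.Injective x)
    (hy : Function.Injective y) :
    ∑ σ : Equiv.Perm (Fin n), Real.exp (t * rankStat f x (y ∘ σ)) =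
      ∑ π : Equiv.Perm (Fin n), Real.exp (t * permStat f n π) := by
  obtain ⟨a, ha⟩ := exists_perm_rank hx
  obtain ⟨b, hb⟩ := exists_perm_rank hy
  refine Fintype.sum_equiv ((Equiv.mulLeft b).trans (Equiv.mulRight a⁻¹)) _ _ fun σ => ?_
  congr 2
  rw [permStat, ← Equiv.sum_comp a]
  refine Finset.sum_congr rfl fun i _ => ?_
  rw [rank_comp, ha, hb]
  simp

lemma measurable_rankStat {f : ℝ × ℝ → ℝ} (hf : Measurable f) :
    Measurable fun p : (Fin n → ℝ) × (Fin n → ℝ) => rankStat f p.1 p.2 :=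
  Finset.measurable_sum _ fun i _ => hf.comp
    ((((measurable_rank i).comp measurable_fst).div_const _).prodMk
      (((measurable_rank i).comp measurable_snd).div_const _))

lemma measurePreserving_comp_perm (σ : Equiv.Perm (Fin n)) :
    MeasurePreserving (fun y : Fin n → ℝ => y ∘ σ) (Measure.pi fun _ => unif01)
      (Measure.pi fun _ => unif01) := by
  have h := measurePreserving_piCongrLeft (α := fun _ : Fin n => ℝ) (fun _ => unif01) σ.symm
  convert h using 1
  ext y i
  have := Equiv.piCongrLeft_apply_apply (P := fun _ : Fin n => ℝ) σ.symm y (σ i)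
  simp only [Equiv.symm_apply_apply] at this
  exact this.symm

lemma ae_injective : ∀ᵐ x ∂(Measure.pi fun _ : Fin n => unif01), Function.Injective x := by
  have h : ∀ i j : Fin n, i ≠ j → ∀ᵐ x ∂(Measure.pi fun _ : Fin n => unif01), x i ≠ x j := by
    intro i j hij
    have h1 : volume {x : Fin n → ℝ | x i = x j} = 0 := by
      set V : Submodule ℝ (Fin n → ℝ) :=
        LinearMap.ker (LinearMap.proj (R := ℝ) (φ := fun _ : Fin n => ℝ) i -
          LinearMap.proj (R := ℝ) (φ := fun _ : Fin n => ℝ) j) with hV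
      have hmem : ∀ x, x ∈ V ↔ x i = x j := fun x => by simp [hV, sub_eq_zero]
      have : {x : Fin n → ℝ | x i = x j} = V := by ext x; simp [hmem]
      rw [this]
      refine Measure.addHaar_submodule volume V fun htop => ?_
      have : Pi.single i (1 : ℝ) ∈ V := by rw [htop]; trivial
      rw [hmem, Pi.single_eq_same, Pi.single_eq_of_ne hij.symm] at this
      exact one_ne_zero this
    have h2 : (Measure.pi fun _ : Fin n => unif01) ≪ (volume : Measure (Fin n → ℝ)) := by
      rw [show (Measure.pi fun _ : Fin n => unif01) = (volume : Measure (Fin n → ℝ)).restrict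
        (Set.univ.pi fun _ => Set.Icc 0 1) from (Measure.restrict_pi_pi _ _).symm]
      exact Measure.restrict_le_self.absolutelyContinuous
    exact h2.ae_le (show ∀ᵐ x : Fin n → ℝ, x i ≠ x j by rw [ae_iff]; simpa using h1)
  have h' : ∀ᵐ x ∂(Measure.pi fun _ : Fin n => unif01), ∀ i j : Fin n, i ≠ j → x i ≠ x j := by
    rw [ae_all_iff]; intro i
    rw [ae_all_iff]; intro j
    by_cases hij : i = j
    · exact ae_of_all _ fun _ h => absurd hij h
    · filter_upwards [h i j hij] with x hx _ using hx
  filter_upwards [h'] with x hx i j hij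
  by_contra hne
  exact hx i j hne hij

lemma lintegral_exp_rankStat_comp {f : ℝ × ℝ → ℝ} (hf : Measurable f) (t : ℝ)
    (σ : Equiv.Perm (Fin n)) (N : Measure (Fin n → ℝ)) [SFinite N]
    (hN : MeasurePreserving (fun y : Fin n → ℝ => y ∘ σ) N N) :
    ∫⁻ p, ENNReal.ofReal (Real.exp (t * rankStat f p.1 (p.2 ∘ σ))) ∂(N.prod N) =
      ∫⁻ p, ENNReal.ofReal (Real.exp (t * rankStat f p.1 p.2)) ∂(N.prod N) :=
  ((MeasurePreserving.id N).prod hN).lintegral_comp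
    (f := fun p => ENNReal.ofReal (Real.exp (t * rankStat f p.1 p.2)))
    (Real.measurable_exp.comp ((measurable_rankStat hf).const_mul t)).ennreal_ofReal

lemma lintegral_sum_exp_rankStat {f : ℝ × ℝ → ℝ} (t : ℝ)
    (N : Measure (Fin n → ℝ)) [IsProbabilityMeasure N]
    (hN : ∀ᵐ x ∂N, Function.Injective x) :
    ∫⁻ p, ∑ σ : Equiv.Perm (Fin n), ENNReal.ofReal (Real.exp (t * rankStat f p.1 (p.2 ∘ σ)))
      ∂(N.prod N) = ENNReal.ofReal (∑ π : Equiv.Perm (Fin n), Real.exp (t * permStat f n π)) := by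
  have hae : ∀ᵐ p ∂(N.prod N), Function.Injective p.1 ∧ Function.Injective p.2 :=
    (Measure.quasiMeasurePreserving_fst.ae hN).and (Measure.quasiMeasurePreserving_snd.ae hN)
  have h : (fun p : (Fin n → ℝ) × (Fin n → ℝ) => ∑ σ : Equiv.Perm (Fin n),
      ENNReal.ofReal (Real.exp (t * rankStat f p.1 (p.2 ∘ σ)))) =ᵐ[N.prod N] fun _ =>
      ENNReal.ofReal (∑ π : Equiv.Perm (Fin n), Real.exp (t * permStat f n π)) := by
    filter_upwards [hae] with p hp
    rw [← sum_exp_rankStat f t hp.1 hp.2,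
      ENNReal.ofReal_sum_of_nonneg fun _ _ => (Real.exp_pos _).le]
  rw [lintegral_congr_ae h, lintegral_const, measure_univ, mul_one]

open scoped Nat in
lemma factorial_mul_lintegral_exp_rankStat {f : ℝ × ℝ → ℝ} (hf : Measurable f) (t : ℝ) :
    (n ! : ℝ≥0∞) * ∫⁻ p, ENNReal.ofReal (Real.exp (t * rankStat f p.1 p.2))
      ∂((Measure.pi fun _ : Fin n => unif01).prod (Measure.pi fun _ : Fin n => unif01)) =
      ENNReal.ofReal (∑ π : Equiv.Perm (Fin n), Real.exp (t * permStat f n π)) := by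
  have hm : ∀ σ : Equiv.Perm (Fin n), Measurable fun p : (Fin n → ℝ) × (Fin n → ℝ) =>
      ENNReal.ofReal (Real.exp (t * rankStat f p.1 (p.2 ∘ σ))) := fun σ =>
    (Real.measurable_exp.comp (((measurable_rankStat hf).comp
      (measurable_id.prodMap (measurePreserving_comp_perm σ).measurable)).const_mul
        t)).ennreal_ofReal
  rw [← lintegral_sum_exp_rankStat t _ ae_injective, lintegral_finsetSum _ fun σ _ => hm σ,
    Finset.sum_congr rfl fun σ _ =>
      lintegral_exp_rankStat_comp hf t σ _ (measurePreserving_comp_perm σ),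
    Finset.sum_const, Finset.card_univ, Fintype.card_perm, Fintype.card_fin, nsmul_eq_mul]

end Rank

section RankVariance

lemma integral_unif01 (g : ℝ → ℝ) : ∫ x, g x ∂unif01 = ∫ x in (0 : ℝ)..1, g x := by
  rw [unif01, integral_Icc_eq_integral_Ioc, ← intervalIntegral.integral_of_le zero_le_one]

lemma ae_unif01_mem : ∀ᵐ x ∂unif01, x ∈ Set.Icc (0 : ℝ) 1 :=
  ae_restrict_mem measurableSet_Icc

lemma integral_prod_mul_indicator_le :
    ∫ p : ℝ × ℝ, p.1 * (if p.2 ≤ p.1 then 1 else 0) ∂(unif01.prod unif01) = 1 / 3 := by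
  have hm : Measurable fun p : ℝ × ℝ => p.1 * (if p.2 ≤ p.1 then (1 : ℝ) else 0) :=
    measurable_fst.mul (Measurable.ite (measurableSet_le measurable_snd measurable_fst)
      measurable_const measurable_const)
  rw [integral_prod]
  · have h : (fun x : ℝ => ∫ y, x * (if y ≤ x then (1 : ℝ) else 0) ∂unif01) =ᵐ[unif01]
        fun x => x ^ 2 := by
      filter_upwards [ae_unif01_mem] with x hx
      have h1 : (fun y : ℝ => if y ≤ x then (1 : ℝ) else 0) =
          (Set.Iic x).indicator fun _ => (1 : ℝ) := by
        ext y; simp [Set.indicator_apply]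
      have h2 : Set.Iic x ∩ Set.Icc 0 1 = Set.Icc 0 x := by
        ext y
        simp only [Set.mem_inter_iff, Set.mem_Iic, Set.mem_Icc]
        exact ⟨fun h => ⟨h.2.1, h.1⟩, fun h => ⟨h.2, h.1, h.2.trans hx.2⟩⟩
      rw [integral_const_mul, h1, integral_indicator measurableSet_Iic, setIntegral_const,
        unif01, measureReal_restrict_apply measurableSet_Iic, h2, Real.volume_real_Icc_of_le hx.1]
      simp; ring
    rw [integral_congr_ae h, integral_unif01, integral_pow]
    norm_num
  · refine Integrable.of_bound hm.aestronglyMeasurable 1 ?_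
    filter_upwards [ae_mem_unitSq] with p hp
    rw [Real.norm_eq_abs, abs_le]
    obtain ⟨⟨h1, h2⟩, -⟩ := hp
    split_ifs <;> constructor <;> linarith

variable {n : ℕ}

lemma ae_pi_unif01_mem :
    ∀ᵐ x ∂(Measure.pi fun _ : Fin n => unif01), ∀ i, x i ∈ Set.Icc (0 : ℝ) 1 := by
  rw [ae_all_iff]
  exact fun i => (measurePreserving_eval (fun _ : Fin n => unif01) i).quasiMeasurePreserving.ae
    ae_unif01_mem

lemma map_eval_pair {i j : Fin n} (hij : i ≠ j) :
    (Measure.pi fun _ : Fin n => unif01).map (fun x => (x i, x j)) = unif01.prod unif01 := by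
  have h := (ProbabilityTheory.iIndepFun_pi (μ := fun _ : Fin n => unif01)
    (X := fun _ => (id : ℝ → ℝ)) fun _ => aemeasurable_id).indepFun hij
  replace h := h.map_prod_eq_prod_map_map (measurable_pi_apply i).aemeasurable
    (measurable_pi_apply j).aemeasurable
  have hi := (measurePreserving_eval (fun _ : Fin n => unif01) i).map_eq
  have hj := (measurePreserving_eval (fun _ : Fin n => unif01) j).map_eq
  exact h.trans (congrArg₂ Measure.prod hi hj)

lemma integral_pi_eval (i : Fin n) {g : ℝ → ℝ} (hg : Measurable g) :
    ∫ x, g (x i) ∂(Measure.pi fun _ : Fin n => unif01) = ∫ x, g x ∂unif01 := by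
  have h := measurePreserving_eval (fun _ : Fin n => unif01) i
  conv_rhs => rw [← h.map_eq, integral_map h.measurable.aemeasurable hg.aestronglyMeasurable]

lemma rank_nonneg (x : Fin n → ℝ) (i : Fin n) : 0 ≤ rank x i := by
  rw [rank_eq_card]; positivity

lemma rank_le_natCast (x : Fin n → ℝ) (i : Fin n) : rank x i ≤ n := by
  rw [rank_eq_card]
  exact_mod_cast (Finset.card_le_univ _).trans_eq (Fintype.card_fin n)

lemma sum_sq_fin (n : ℕ) : ∑ i : Fin n, ((i.1 : ℝ) + 1) ^ 2 =
    (n : ℝ) * (n + 1) * (2 * n + 1) / 6 := by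
  rw [Fin.sum_univ_eq_sum_range fun i => ((i : ℝ) + 1) ^ 2]
  induction n with
  | zero => simp
  | succ k ih => rw [Finset.sum_range_succ, ih]; push_cast; ring

lemma integral_mul_rank (i : Fin n) :
    ∫ x, x i * rank x i ∂(Measure.pi fun _ : Fin n => unif01) = (n - 1) / 3 + 1 / 2 := by
  have hm : ∀ j, Measurable fun x : Fin n → ℝ => x i * (if x j ≤ x i then (1 : ℝ) else 0) :=
    fun j => (measurable_pi_apply i).mul (Measurable.ite
      (measurableSet_le (measurable_pi_apply j) (measurable_pi_apply i)) measurable_const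
      measurable_const)
  have hint : ∀ j, Integrable (fun x : Fin n → ℝ => x i * (if x j ≤ x i then (1 : ℝ) else 0))
      (Measure.pi fun _ : Fin n => unif01) := fun j => by
    refine Integrable.of_bound (hm j).aestronglyMeasurable 1 ?_
    filter_upwards [ae_pi_unif01_mem] with x hx
    rw [Real.norm_eq_abs, abs_le]
    obtain ⟨h1, h2⟩ := hx i
    split_ifs <;> constructor <;> linarith
  have hval : ∀ j, ∫ x, x i * (if x j ≤ x i then (1 : ℝ) else 0)
      ∂(Measure.pi fun _ : Fin n => unif01) = 1 / 3 + if j = i then 1 / 6 else 0 := fun j => by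
    by_cases hij : j = i
    · subst hij
      simp only [le_refl, if_true, mul_one]
      rw [integral_pi_eval j measurable_id', integral_unif01, integral_id]
      norm_num
    · rw [if_neg hij, add_zero, ← integral_prod_mul_indicator_le, ← map_eval_pair (Ne.symm hij),
        integral_map]
      · exact ((measurable_pi_apply i).prodMk (measurable_pi_apply j)).aemeasurable
      · exact (measurable_fst.mul (Measurable.ite (measurableSet_le measurable_snd measurable_fst)
          measurable_const measurable_const)).aestronglyMeasurable
  simp only [rank, Finset.mul_sum]
  rw [integral_finsetSum _ fun j _ => hint j]
  simp only [hval]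
  rw [Finset.sum_add_distrib]
  simp
  ring

lemma integral_sum_rank_sub_sq_le (hn : 0 < n) :
    Integrable (fun x => ∑ i, (rank x i / n - x i) ^ 2) (Measure.pi fun _ : Fin n => unif01) ∧
    ∫ x, ∑ i, (rank x i / n - x i) ^ 2 ∂(Measure.pi fun _ : Fin n => unif01) ≤ 1 := by
  have hn0 : (0 : ℝ) < n := by exact_mod_cast hn
  have hn1 : (1 : ℝ) ≤ n := by exact_mod_cast hn
  have hae : (fun x : Fin n → ℝ => ∑ i, (rank x i / n - x i) ^ 2)
      =ᵐ[Measure.pi fun _ : Fin n => unif01] fun x =>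
      ((n : ℝ) + 1) * (2 * n + 1) / (6 * n) + ∑ i, (x i ^ 2 - 2 / n * (x i * rank x i)) := by
    filter_upwards [ae_injective] with x hx
    obtain ⟨σ, hσ⟩ := exists_perm_rank hx
    have h1 : ∑ i, rank x i ^ 2 = n * (n + 1) * (2 * n + 1) / 6 := by
      rw [← sum_sq_fin n, ← Equiv.sum_comp σ fun j => ((j.1 : ℝ) + 1) ^ 2]
      exact Finset.sum_congr rfl fun i _ => by rw [hσ]
    have h2 : ∑ i, (rank x i / n - x i) ^ 2 = (∑ i, rank x i ^ 2) / n ^ 2 +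
        ∑ i, (x i ^ 2 - 2 / n * (x i * rank x i)) := by
      rw [Finset.sum_div, ← Finset.sum_add_distrib]
      refine Finset.sum_congr rfl fun i _ => ?_
      field_simp
      ring
    rw [h2, h1]
    field_simp
  have hi1 : ∀ i, Integrable (fun x : Fin n → ℝ => x i ^ 2)
      (Measure.pi fun _ : Fin n => unif01) := fun i => by
    refine Integrable.of_bound ((measurable_pi_apply i).pow_const 2).aestronglyMeasurable 1 ?_
    filter_upwards [ae_pi_unif01_mem] with x hx
    rw [Real.norm_eq_abs, abs_le]
    obtain ⟨h1, h2⟩ := hx i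
    constructor <;> nlinarith
  have hi2 : ∀ i, Integrable (fun x : Fin n → ℝ => x i * rank x i)
      (Measure.pi fun _ : Fin n => unif01) := fun i => by
    refine Integrable.of_bound
      ((measurable_pi_apply i).mul (measurable_rank i)).aestronglyMeasurable n ?_
    filter_upwards [ae_pi_unif01_mem] with x hx
    rw [Real.norm_eq_abs, abs_le]
    obtain ⟨h1, h2⟩ := hx i
    have h3 := rank_nonneg x i
    have h4 := rank_le_natCast x i
    constructor <;> nlinarith
  have hi3 : ∀ i, Integrable (fun x : Fin n → ℝ => x i ^ 2 - 2 / n * (x i * rank x i))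
      (Measure.pi fun _ : Fin n => unif01) := fun i => (hi1 i).sub ((hi2 i).const_mul _)
  have hi4 := integrable_finsetSum Finset.univ fun i _ => hi3 i
  refine ⟨(((integrable_const _).add hi4).congr hae.symm), ?_⟩
  rw [integral_congr_ae hae, integral_add (integrable_const _) hi4,
    integral_finsetSum _ fun i _ => hi3 i]
  have hval : ∀ i, ∫ x : Fin n → ℝ, x i ^ 2 - 2 / n * (x i * rank x i)
      ∂(Measure.pi fun _ : Fin n => unif01) = 1 / 3 - 2 / (n : ℝ) * ((n - 1) / 3 + 1 / 2) :=
    fun i => by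
    rw [integral_sub (hi1 i) ((hi2 i).const_mul _), integral_const_mul, integral_mul_rank,
      integral_pi_eval i (measurable_id'.pow_const 2), integral_unif01, integral_pow]
    norm_num
  simp only [hval, Finset.sum_const, Finset.card_univ, Fintype.card_fin, nsmul_eq_mul,
    integral_const, probReal_univ, one_smul]
  have : ((n : ℝ) + 1) * (2 * n + 1) / (6 * n) +
      n * (1 / 3 - 2 / n * ((n - 1) / 3 + 1 / 2)) = 1 / 6 + 1 / (6 * n) := by
    field_simp
    ring
  rw [this]
  have : 1 / (6 * (n : ℝ)) ≤ 1 / 6 := one_div_le_one_div_of_le (by norm_num) (by linarith)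
  linarith

end RankVariance

section LowerBound

variable {n : ℕ} {f ρ : ℝ × ℝ → ℝ} {M t : ℝ}

lemma abs_rankStat_le (hM : ∀ p, |f p| ≤ M) (x y : Fin n → ℝ) : |rankStat f x y| ≤ n * M := by
  refine (Finset.abs_sum_le_sum_abs _ _).trans ((Finset.sum_le_sum fun i _ => hM _).trans_eq ?_)
  simp

lemma measurable_rankStat_pi (hf : Measurable f) :
    Measurable fun z : Fin n → ℝ × ℝ => rankStat f (fun i => (z i).1) (fun i => (z i).2) := by
  have h1 : Measurable fun (z : Fin n → ℝ × ℝ) (i : Fin n) => (z i).1 :=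
    measurable_pi_lambda _ fun i => measurable_fst.comp (measurable_pi_apply i)
  have h2 : Measurable fun (z : Fin n → ℝ × ℝ) (i : Fin n) => (z i).2 :=
    measurable_pi_lambda _ fun i => measurable_snd.comp (measurable_pi_apply i)
  have h := (measurable_rankStat hf).comp (h1.prodMk h2)
  simpa only [Function.comp_def] using h

open scoped Nat in
lemma exp_integral_rankStat_sub_ent_le (hρ : IsDens ρ)
    (hi : Integrable (fun p => ρ p * Real.log (ρ p)) usq) (hf : Measurable f)
    (hM : ∀ p, |f p| ≤ M) (t : ℝ) :
    (n ! : ℝ) * Real.exp (t * (∫ z : Fin n → ℝ × ℝ,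
      rankStat f (fun i => (z i).1) (fun i => (z i).2) ∂(Measure.pi fun _ => densMeasure ρ)) -
        n * ent ρ) ≤ ∑ π : Equiv.Perm (Fin n), Real.exp (t * permStat f n π) := by
  have hprob : IsProbabilityMeasure (usq.withDensity fun p => ENNReal.ofReal (ρ p)) :=
    hρ.isProbabilityMeasure
  have hF : Measurable fun z : Fin n → ℝ × ℝ =>
      t * rankStat f (fun i => (z i).1) (fun i => (z i).2) :=
    (measurable_rankStat_pi hf).const_mul t
  have h1 := ofReal_exp_sub_entropy_le (ι := Fin n) (N := usq) hρ.meas hρ.nonneg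
    ((hρ.integrable_densMeasure_iff _).2 hi) hF (C := |t| * (n * M)) fun z => by
      rw [abs_mul]
      exact mul_le_mul_of_nonneg_left (abs_rankStat_le hM _ _) (abs_nonneg t)
  have h2 := (measurePreserving_arrowProdEquivProdArrow ℝ ℝ (Fin n) (fun _ => unif01)
    fun _ => unif01).lintegral_comp
    (f := fun p => ENNReal.ofReal (Real.exp (t * rankStat f p.1 p.2)))
    (Real.measurable_exp.comp ((measurable_rankStat hf).const_mul t)).ennreal_ofReal
  have h3 : ∫⁻ z : Fin n → ℝ × ℝ, ENNReal.ofReal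
      (Real.exp (t * rankStat f (fun i => (z i).1) (fun i => (z i).2)))
      ∂(Measure.pi fun _ => usq) =
      ∫⁻ p, ENNReal.ofReal (Real.exp (t * rankStat f p.1 p.2))
        ∂((Measure.pi fun _ : Fin n => unif01).prod (Measure.pi fun _ : Fin n => unif01)) := h2
  rw [h3] at h1
  have h4 := mul_le_mul_right h1 (n ! : ℝ≥0∞)
  rw [factorial_mul_lintegral_exp_rankStat hf t, ← ENNReal.ofReal_natCast,
    ← ENNReal.ofReal_mul (Nat.cast_nonneg _),
    ENNReal.ofReal_le_ofReal_iff (Finset.sum_nonneg fun _ _ => (Real.exp_pos _).le)] at h4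
  have h5 : ∫ p, Real.log (ρ p) ∂(usq.withDensity fun p => ENNReal.ofReal (ρ p)) = ent ρ :=
    hρ.integral_densMeasure _
  rwa [h5, Fintype.card_fin, integral_const_mul] at h4

open scoped Nat in
lemma integral_rankStat_sub_ent_le_Zn (hρ : IsDens ρ)
    (hi : Integrable (fun p => ρ p * Real.log (ρ p)) usq) (hf : Measurable f)
    (hM : ∀ p, |f p| ≤ M) (t : ℝ) :
    t * (∫ z : Fin n → ℝ × ℝ, rankStat f (fun i => (z i).1) (fun i => (z i).2)
      ∂(Measure.pi fun _ => densMeasure ρ)) - n * ent ρ ≤ Zn f t n - Real.log (n ! : ℝ) := by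
  have h := exp_integral_rankStat_sub_ent_le (n := n) hρ hi hf hM t
  have hn : (0 : ℝ) < (n ! : ℝ) := by exact_mod_cast Nat.factorial_pos n
  have h1 := Real.log_le_log (mul_pos hn (Real.exp_pos _)) h
  rw [Real.log_mul hn.ne' (Real.exp_pos _).ne', Real.log_exp] at h1
  rw [Zn]
  linarith

lemma measurePreserving_fst_densMeasure (hρ : IsDens ρ) :
    MeasurePreserving Prod.fst (densMeasure ρ) unif01 := ⟨measurable_fst, hρ.mem_MM.2.1⟩

lemma measurePreserving_snd_densMeasure (hρ : IsDens ρ) :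
    MeasurePreserving Prod.snd (densMeasure ρ) unif01 := ⟨measurable_snd, hρ.mem_MM.2.2⟩

lemma integral_sum_rank_comp_sub_sq_le (hn : 0 < n) {N : Measure (ℝ × ℝ)} [SigmaFinite N]
    {c : ℝ × ℝ → ℝ} (hc : MeasurePreserving c N unif01) :
    Integrable (fun z : Fin n → ℝ × ℝ => ∑ i, (rank (fun i => c (z i)) i / n - c (z i)) ^ 2)
      (Measure.pi fun _ => N) ∧
    ∫ z : Fin n → ℝ × ℝ, ∑ i, (rank (fun i => c (z i)) i / n - c (z i)) ^ 2
      ∂(Measure.pi fun _ => N) ≤ 1 := by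
  obtain ⟨h1, h2⟩ := integral_sum_rank_sub_sq_le hn
  have h := measurePreserving_pi (fun _ : Fin n => N) (fun _ => unif01) fun _ => hc
  refine ⟨h.integrable_comp_of_integrable h1, ?_⟩
  rw [← h.map_eq] at h2 h1
  rwa [integral_map h.measurable.aemeasurable h1.aestronglyMeasurable] at h2

lemma abs_sub_le_add_sq {ε δ : ℝ} (hM0 : 0 ≤ M) (hM : ∀ p, |f p| ≤ M) (hε : 0 ≤ ε) (hδ : 0 < δ)
    (hmod : ∀ p q : ℝ × ℝ, |p.1 - q.1| ≤ δ → |p.2 - q.2| ≤ δ → |f p - f q| ≤ ε)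
    (p q : ℝ × ℝ) :
    |f p - f q| ≤ ε + 2 * M / δ ^ 2 * ((p.1 - q.1) ^ 2 + (p.2 - q.2) ^ 2) := by
  have hb : |f p - f q| ≤ 2 * M := (abs_sub _ _).trans (by linarith [hM p, hM q])
  have h0 : 0 ≤ 2 * M / δ ^ 2 := by positivity
  have key : δ ^ 2 ≤ (p.1 - q.1) ^ 2 + (p.2 - q.2) ^ 2 →
      |f p - f q| ≤ ε + 2 * M / δ ^ 2 * ((p.1 - q.1) ^ 2 + (p.2 - q.2) ^ 2) := fun h => by
    have h1 := mul_le_mul_of_nonneg_left h h0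
    rw [div_mul_cancel₀ _ (by positivity)] at h1
    linarith
  by_cases h1 : |p.1 - q.1| ≤ δ
  · by_cases h2 : |p.2 - q.2| ≤ δ
    · have := hmod p q h1 h2
      have : 0 ≤ 2 * M / δ ^ 2 * ((p.1 - q.1) ^ 2 + (p.2 - q.2) ^ 2) := by positivity
      linarith
    · refine key ?_
      have := sq_lt_sq' (by linarith [abs_nonneg (p.2 - q.2)]) (not_le.1 h2)
      rw [sq_abs] at this
      nlinarith [sq_nonneg (p.1 - q.1)]
  · refine key ?_
    have := sq_lt_sq' (by linarith [abs_nonneg (p.1 - q.1)]) (not_le.1 h1)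
    rw [sq_abs] at this
    nlinarith [sq_nonneg (p.2 - q.2)]

lemma abs_integral_rankStat_sub_le (hn : 0 < n) (hρ : IsDens ρ) (hf : Measurable f) {ε δ : ℝ}
    (hM0 : 0 ≤ M) (hM : ∀ p, |f p| ≤ M) (hε : 0 ≤ ε) (hδ : 0 < δ)
    (hmod : ∀ p q : ℝ × ℝ, |p.1 - q.1| ≤ δ → |p.2 - q.2| ≤ δ → |f p - f q| ≤ ε) :
    |(∫ z : Fin n → ℝ × ℝ, rankStat f (fun i => (z i).1) (fun i => (z i).2)
      ∂(Measure.pi fun _ => densMeasure ρ)) - n * ∫ p, ρ p * f p ∂usq| ≤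
      n * ε + 2 * M / δ ^ 2 * 2 := by
  have hprob := hρ.isProbabilityMeasure
  set P := Measure.pi fun _ : Fin n => densMeasure ρ with hP
  have hi1 : Integrable (fun z : Fin n → ℝ × ℝ =>
      rankStat f (fun i => (z i).1) (fun i => (z i).2)) P :=
    Integrable.of_bound (measurable_rankStat_pi hf).aestronglyMeasurable (n * M)
      (ae_of_all _ fun z => abs_rankStat_le hM _ _)
  have hi2 : ∀ i, Integrable (fun z : Fin n → ℝ × ℝ => f (z i)) P := fun i =>
    Integrable.of_bound (hf.comp (measurable_pi_apply i)).aestronglyMeasurable M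
      (ae_of_all _ fun z => hM _)
  have hi3 := integrable_finsetSum Finset.univ fun i _ => hi2 i
  have hval : ∫ z : Fin n → ℝ × ℝ, ∑ i, f (z i) ∂P = n * ∫ p, ρ p * f p ∂usq := by
    rw [integral_finsetSum _ fun i _ => hi2 i]
    have : ∀ i, ∫ z : Fin n → ℝ × ℝ, f (z i) ∂P = ∫ p, ρ p * f p ∂usq := fun i => by
      have h := measurePreserving_eval (fun _ : Fin n => densMeasure ρ) i
      rw [← hρ.integral_densMeasure, ← h.map_eq,
        integral_map h.measurable.aemeasurable hf.aestronglyMeasurable]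
    simp [this]
  obtain ⟨ha1, ha2⟩ := integral_sum_rank_comp_sub_sq_le hn (measurePreserving_fst_densMeasure hρ)
  obtain ⟨hb1, hb2⟩ := integral_sum_rank_comp_sub_sq_le hn (measurePreserving_snd_densMeasure hρ)
  rw [← hP] at ha1 ha2 hb1 hb2
  rw [← hval, ← integral_sub hi1 hi3]
  refine (abs_integral_le_integral_abs).trans ?_
  have hle : ∀ z : Fin n → ℝ × ℝ,
      |rankStat f (fun i => (z i).1) (fun i => (z i).2) - ∑ i, f (z i)| ≤
      n * ε + 2 * M / δ ^ 2 * ((∑ i, (rank (fun i => (z i).1) i / n - (z i).1) ^ 2) +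
        ∑ i, (rank (fun i => (z i).2) i / n - (z i).2) ^ 2) := fun z => by
    rw [rankStat, ← Finset.sum_sub_distrib, ← Finset.sum_add_distrib, Finset.mul_sum]
    have : (n : ℝ) * ε = ∑ _i : Fin n, ε := by simp
    rw [this, ← Finset.sum_add_distrib]
    exact (Finset.abs_sum_le_sum_abs _ _).trans
      (Finset.sum_le_sum fun i _ => abs_sub_le_add_sq hM0 hM hε hδ hmod _ _)
  refine (integral_mono (hi1.sub hi3).abs
    ((integrable_const _).add ((ha1.add hb1).const_mul (2 * M / δ ^ 2))) hle).trans ?_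
  rw [integral_add' (integrable_const _) ((ha1.add hb1).const_mul _), integral_const,
    integral_const_mul, integral_add' ha1 hb1, probReal_univ, one_smul]
  have h0 : 0 ≤ 2 * M / δ ^ 2 := by positivity
  have := mul_le_mul_of_nonneg_left (add_le_add ha2 hb2) h0
  linarith

lemma eventually_le_pressure (hf : UniformContinuous f) (hM : ∀ p, |f p| ≤ M)
    (hρ : IsOpt f t ρ) {ε : ℝ} (hε : 0 < ε) :
    ∀ᶠ n in atTop, t * (∫ p, ρ p * f p ∂usq) - ent ρ - ε ≤ pressure f n t := by
  have hM0 : 0 ≤ M := (abs_nonneg _).trans (hM 0)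
  obtain ⟨δ, hδ, hmod⟩ := hf.exists_modulus (η := ε / (2 * (|t| + 1))) (by positivity)
  have hlim : Tendsto (fun n : ℕ => |t| * (2 * M / δ ^ 2 * 2) / (n : ℝ)) atTop (𝓝 0) :=
    tendsto_const_div_atTop_nhds_zero_nat _
  filter_upwards [hlim.eventually (gt_mem_nhds (half_pos hε)), eventually_gt_atTop 0]
    with n hn hn0
  have hn0' : (0 : ℝ) < n := by exact_mod_cast hn0
  have h1 := integral_rankStat_sub_ent_le_Zn (n := n) hρ.dens hρ.int hf.continuous.measurable hM t
  have h2 := abs_integral_rankStat_sub_le hn0 hρ.dens hf.continuous.measurable hM0 hM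
    (by positivity) hδ hmod
  set I := ∫ z : Fin n → ℝ × ℝ, rankStat f (fun i => (z i).1) (fun i => (z i).2)
    ∂(Measure.pi fun _ => densMeasure ρ)
  have h3 := mul_le_mul_of_nonneg_left h2 (abs_nonneg t)
  rw [← abs_mul] at h3
  have h4 := neg_abs_le (t * (I - n * ∫ p, ρ p * f p ∂usq))
  have h5 : |t| * (ε / (2 * (|t| + 1))) ≤ ε / 2 := by
    rw [mul_div_assoc', div_le_div_iff₀ (by positivity) (by positivity)]
    nlinarith
  rw [pressure, le_div_iff₀ hn0']
  rw [div_lt_iff₀ hn0'] at hn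
  nlinarith

lemma tendsto_pressure (hf : UniformContinuous f) (hM : ∀ p, |f p| ≤ M) (hρ : IsOpt f t ρ) :
    Tendsto (fun n => pressure f n t) atTop (𝓝 (t * (∫ p, ρ p * f p ∂usq) - ent ρ)) := by
  rw [Metric.tendsto_nhds]
  intro ε hε
  filter_upwards [eventually_le_pressure hf hM hρ (half_pos hε),
    eventually_pressure_le hf hM hρ (half_pos hε)] with n h1 h2
  rw [Real.dist_eq, abs_lt]
  constructor <;> linarith

end LowerBound

section FiniteGibbs

variable {α : Type*} [Fintype α]

/-- The mean of `S` under the Gibbs distribution with weights proportional to `exp (t * S)`. -/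
def gibbsMean (S : α → ℝ) (t : ℝ) : ℝ :=
  (∑ i, S i * Real.exp (t * S i)) / ∑ i, Real.exp (t * S i)

lemma hasDerivAt_sum_exp (S : α → ℝ) (t : ℝ) :
    HasDerivAt (fun s => ∑ i, Real.exp (s * S i)) (∑ i, S i * Real.exp (t * S i)) t := by
  refine HasDerivAt.fun_sum fun i _ => ?_
  have h := ((hasDerivAt_id t).mul_const (S i)).exp
  simp only [id, one_mul] at h
  rwa [mul_comm] at h

lemma sum_exp_mul_exp (S : α → ℝ) (s t c : ℝ) :
    ∑ i, Real.exp (t * S i) * Real.exp ((s - t) * (S i - c)) =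
      (∑ i, Real.exp (s * S i)) * Real.exp (-((s - t) * c)) := by
  rw [Finset.sum_mul]
  refine Finset.sum_congr rfl fun i _ => ?_
  rw [← Real.exp_add, ← Real.exp_add]
  congr 1
  ring

variable [Nonempty α]

lemma sum_exp_pos (S : α → ℝ) (t : ℝ) : 0 < ∑ i, Real.exp (t * S i) :=
  Finset.sum_pos (fun _ _ => Real.exp_pos _) Finset.univ_nonempty

lemma hasDerivAt_log_sum_exp (S : α → ℝ) (t : ℝ) :
    HasDerivAt (fun s => Real.log (∑ i, Real.exp (s * S i))) (gibbsMean S t) t :=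
  (hasDerivAt_sum_exp S t).log (sum_exp_pos S t).ne'

lemma continuous_gibbsMean (S : α → ℝ) : Continuous (gibbsMean S) := by
  refine Continuous.div (by fun_prop) (by fun_prop) fun t => (sum_exp_pos S t).ne'

lemma sum_exp_mul_sub_gibbsMean (S : α → ℝ) (t : ℝ) :
    ∑ i, Real.exp (t * S i) * (S i - gibbsMean S t) = 0 := by
  have h : ∑ i, Real.exp (t * S i) * (S i - gibbsMean S t) =
      ∑ i, S i * Real.exp (t * S i) - gibbsMean S t * ∑ i, Real.exp (t * S i) := by
    rw [Finset.mul_sum, ← Finset.sum_sub_distrib]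
    exact Finset.sum_congr rfl fun i _ => by ring
  rw [h, gibbsMean, div_mul_cancel₀ _ (sum_exp_pos S t).ne', sub_self]

lemma log_sum_exp_add_le (S : α → ℝ) (s t : ℝ) :
    Real.log (∑ i, Real.exp (t * S i)) + (s - t) * gibbsMean S t ≤
      Real.log (∑ i, Real.exp (s * S i)) := by
  have h1 : ∑ i, Real.exp (t * S i) ≤
      ∑ i, Real.exp (t * S i) * Real.exp ((s - t) * (S i - gibbsMean S t)) := by
    have h2 : ∑ i, Real.exp (t * S i) =
        ∑ i, Real.exp (t * S i) * ((s - t) * (S i - gibbsMean S t) + 1) := by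
      have := sum_exp_mul_sub_gibbsMean S t
      simp only [mul_add, mul_one, Finset.sum_add_distrib, mul_left_comm _ (s - t),
        ← Finset.mul_sum, this, mul_zero, zero_add]
    rw [h2]
    exact Finset.sum_le_sum fun i _ => mul_le_mul_of_nonneg_left (Real.add_one_le_exp _)
      (Real.exp_pos _).le
  rw [sum_exp_mul_exp] at h1
  have h3 := Real.log_le_log (sum_exp_pos S t) h1
  rw [Real.log_mul (sum_exp_pos S s).ne' (Real.exp_pos _).ne', Real.log_exp] at h3
  linarith

lemma log_sum_exp_add_lt {S : α → ℝ} (hS : ∃ i j, S i ≠ S j) {s t : ℝ} (hst : s ≠ t) :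
    Real.log (∑ i, Real.exp (t * S i)) + (s - t) * gibbsMean S t <
      Real.log (∑ i, Real.exp (s * S i)) := by
  have h1 : ∑ i, Real.exp (t * S i) <
      ∑ i, Real.exp (t * S i) * Real.exp ((s - t) * (S i - gibbsMean S t)) := by
    have h2 : ∑ i, Real.exp (t * S i) =
        ∑ i, Real.exp (t * S i) * ((s - t) * (S i - gibbsMean S t) + 1) := by
      have := sum_exp_mul_sub_gibbsMean S t
      simp only [mul_add, mul_one, Finset.sum_add_distrib, mul_left_comm _ (s - t),
        ← Finset.mul_sum, this, mul_zero, zero_add]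
    obtain ⟨i, hi⟩ : ∃ i, S i ≠ gibbsMean S t := by
      by_contra! h
      obtain ⟨i, j, hij⟩ := hS
      exact hij ((h i).trans (h j).symm)
    rw [h2]
    refine Finset.sum_lt_sum (fun i _ => mul_le_mul_of_nonneg_left (Real.add_one_le_exp _)
      (Real.exp_pos _).le) ⟨i, Finset.mem_univ i, mul_lt_mul_of_pos_left
        (Real.add_one_lt_exp ?_) (Real.exp_pos _)⟩
    exact mul_ne_zero (sub_ne_zero.2 hst) (sub_ne_zero.2 hi)
  rw [sum_exp_mul_exp] at h1
  have h3 := Real.log_lt_log (sum_exp_pos S t) h1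
  rw [Real.log_mul (sum_exp_pos S s).ne' (Real.exp_pos _).ne', Real.log_exp] at h3
  linarith

lemma strictMono_gibbsMean {S : α → ℝ} (hS : ∃ i j, S i ≠ S j) : StrictMono (gibbsMean S) := by
  intro s t hst
  have h1 := log_sum_exp_add_lt hS hst.ne
  have h2 := log_sum_exp_add_lt hS hst.ne'
  nlinarith

lemma strictMono_gibbsMean_of_lt {S : α → ℝ} {s t : ℝ} (h : gibbsMean S s < gibbsMean S t) :
    StrictMono (gibbsMean S) := by
  refine strictMono_gibbsMean ?_
  by_contra! hc
  obtain ⟨i⟩ := ‹Nonempty α›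
  have hconst : ∀ r, gibbsMean S r = S i := fun r => by
    rw [gibbsMean, div_eq_iff (sum_exp_pos S r).ne', Finset.mul_sum]
    exact Finset.sum_congr rfl fun j _ => by rw [hc j i]
  rw [hconst, hconst] at h
  exact lt_irrefl _ h

end FiniteGibbs

section Qprob

variable {f : ℝ × ℝ → ℝ} {n : ℕ} {θ : ℝ}

lemma deriv_Zn (f : ℝ × ℝ → ℝ) (n : ℕ) (t : ℝ) :
    deriv (fun s => Zn f s n) t = gibbsMean (permStat f n) t :=
  (hasDerivAt_log_sum_exp (permStat f n) t).deriv

lemma Qprob_nonneg (p : Equiv.Perm (Fin n) → Prop) : 0 ≤ Qprob f θ n p :=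
  Finset.sum_nonneg fun π _ => by split_ifs <;> positivity

lemma Qprob_mono {p q : Equiv.Perm (Fin n) → Prop} (h : ∀ π, p π → q π) :
    Qprob f θ n p ≤ Qprob f θ n q := by
  refine Finset.sum_le_sum fun π _ => ?_
  by_cases hp : p π
  · rw [if_pos hp, if_pos (h π hp)]
  · rw [if_neg hp]; split_ifs <;> positivity

lemma Qprob_or_le (p q : Equiv.Perm (Fin n) → Prop) :
    Qprob f θ n (fun π => p π ∨ q π) ≤ Qprob f θ n p + Qprob f θ n q := by
  rw [Qprob, Qprob, Qprob, ← Finset.sum_add_distrib]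
  refine Finset.sum_le_sum fun π _ => ?_
  have := Real.exp_pos (θ * permStat f n π - Zn f θ n)
  by_cases hp : p π <;> by_cases hq : q π <;> simp [hp, hq, this.le]

lemma sum_exp_sub_Zn (f : ℝ × ℝ → ℝ) (n : ℕ) (s θ c : ℝ) :
    ∑ π : Equiv.Perm (Fin n), Real.exp (s * permStat f n π - Zn f θ n - c) =
      Real.exp (Zn f s n - Zn f θ n - c) := by
  simp only [sub_sub, Real.exp_sub]
  rw [← Finset.sum_div]
  congr 1
  exact (Real.exp_log (sum_exp_pos (permStat f n) s)).symm

lemma Qprob_add_Qprob_not (p : Equiv.Perm (Fin n) → Prop) :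
    Qprob f θ n p + Qprob f θ n (fun π => ¬ p π) = 1 := by
  rw [Qprob, Qprob, ← Finset.sum_add_distrib]
  have h := sum_exp_sub_Zn f n θ θ 0
  simp only [sub_zero, sub_self, Real.exp_zero] at h
  rw [← h]
  refine Finset.sum_congr rfl fun π _ => ?_
  by_cases hp : p π <;> simp [hp]

lemma Qprob_le_exp {p : Equiv.Perm (Fin n) → Prop} {h c : ℝ}
    (hp : ∀ π, p π → h * c ≤ h * permStat f n π) :
    Qprob f θ n p ≤ Real.exp (Zn f (θ + h) n - Zn f θ n - h * c) := by
  rw [← sum_exp_sub_Zn]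
  refine Finset.sum_le_sum fun π _ => ?_
  split_ifs with hpi
  · rw [Real.exp_le_exp]
    linarith [hp π hpi]
  · positivity

end Qprob

section Asymptotics

variable {f : ℝ × ℝ → ℝ} {φ g : ℝ → ℝ} {θ : ℝ}

lemma Zn_sub_Zn_eq {n : ℕ} (hn : 0 < n) (s t : ℝ) :
    Zn f s n - Zn f t n = n * (pressure f n s - pressure f n t) := by
  have : (n : ℝ) ≠ 0 := by exact_mod_cast hn.ne'
  rw [pressure, pressure]
  field_simp
  ring

lemma tendsto_Qprob_tail (hφ : ∀ t, Tendsto (fun n => pressure f n t) atTop (𝓝 (φ t)))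
    (hg : ∀ s t, φ t + (s - t) * g t ≤ φ s) {h a : ℝ} (ha : h * g (θ + h) < h * a)
    {p : ∀ n, Equiv.Perm (Fin n) → Prop}
    (hp : ∀ᶠ n : ℕ in atTop, ∀ π, p n π → h * (n * a) ≤ h * permStat f n π) :
    Tendsto (fun n => Qprob f θ n (p n)) atTop (𝓝 0) := by
  have hlim : Tendsto (fun n => pressure f n (θ + h) - pressure f n θ - h * a) atTop
      (𝓝 (φ (θ + h) - φ θ - h * a)) := ((hφ _).sub (hφ _)).sub_const _
  have hneg : φ (θ + h) - φ θ - h * a < 0 := by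
    have := hg θ (θ + h)
    nlinarith
  have hbot := tendsto_natCast_atTop_atTop.atTop_mul_neg hneg hlim
  refine squeeze_zero' (Eventually.of_forall fun n => Qprob_nonneg _) ?_
    (Real.tendsto_exp_atBot.comp hbot)
  filter_upwards [hp, eventually_gt_atTop 0] with n hn hn0
  refine (Qprob_le_exp hn).trans_eq ?_
  rw [Zn_sub_Zn_eq hn0, Function.comp_apply]
  congr 1
  ring

lemma tendsto_Qprob_zero (hφ : ∀ t, Tendsto (fun n => pressure f n t) atTop (𝓝 (φ t)))
    (hg : ∀ s t, φ t + (s - t) * g t ≤ φ s) (hmono : StrictMono g) {r : ℝ} (hr : 0 < r)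
    {p : ∀ n, Equiv.Perm (Fin n) → Prop}
    (hp : ∀ᶠ n : ℕ in atTop, ∀ π, g (θ - r) < permStat f n π / n → permStat f n π / n < g (θ + r) →
      ¬ p n π) :
    Tendsto (fun n => Qprob f θ n (p n)) atTop (𝓝 0) := by
  have h1 : Tendsto (fun n => Qprob f θ n fun π => permStat f n π ≤ n * g (θ - r)) atTop (𝓝 0) := by
    refine tendsto_Qprob_tail hφ hg (h := -(r / 2)) (a := g (θ - r)) ?_
      (Eventually.of_forall fun n π hπ => ?_)
    · have := hmono (show θ - r < θ + -(r / 2) by linarith)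
      nlinarith
    · nlinarith
  have h2 : Tendsto (fun n => Qprob f θ n fun π => n * g (θ + r) ≤ permStat f n π) atTop (𝓝 0) := by
    refine tendsto_Qprob_tail hφ hg (h := r / 2) (a := g (θ + r)) ?_
      (Eventually.of_forall fun n π hπ => ?_)
    · have := hmono (show θ + r / 2 < θ + r by linarith)
      nlinarith
    · nlinarith
  have h3 := h1.add h2
  rw [add_zero] at h3
  refine squeeze_zero' (Eventually.of_forall fun n => Qprob_nonneg _) ?_ h3
  filter_upwards [hp, eventually_gt_atTop 0] with n hn hn0
  have hn0' : (0 : ℝ) < n := by exact_mod_cast hn0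
  refine (Qprob_mono fun π hπ => ?_).trans (Qprob_or_le _ _)
  by_contra! hc
  refine hn π ?_ ?_ hπ
  · rw [lt_div_iff₀ hn0', mul_comm]; exact hc.1
  · rw [div_lt_iff₀ hn0', mul_comm]; exact hc.2

lemma tendsto_Qprob_one (hφ : ∀ t, Tendsto (fun n => pressure f n t) atTop (𝓝 (φ t)))
    (hg : ∀ s t, φ t + (s - t) * g t ≤ φ s) (hmono : StrictMono g) {r : ℝ} (hr : 0 < r)
    {p : ∀ n, Equiv.Perm (Fin n) → Prop}
    (hp : ∀ᶠ n : ℕ in atTop, ∀ π, g (θ - r) < permStat f n π / n → permStat f n π / n < g (θ + r) →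
      p n π) :
    Tendsto (fun n => Qprob f θ n (p n)) atTop (𝓝 1) := by
  have h := tendsto_Qprob_zero hφ hg hmono hr (p := fun n π => ¬ p n π) (θ := θ)
    (hp.mono fun n hn π h1 h2 => not_not.2 (hn π h1 h2))
  have h' := h.const_sub 1
  rw [sub_zero] at h'
  exact h'.congr fun n => by rw [← Qprob_add_Qprob_not (f := f) (θ := θ) (p n)]; ring

lemma eventually_gibbsMean_lt (hφ : ∀ t, Tendsto (fun n => pressure f n t) atTop (𝓝 (φ t)))
    (hg : ∀ s t, φ t + (s - t) * g t ≤ φ s) {t h c : ℝ} (hc : h * g (t + h) < h * c) :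
    ∀ᶠ n : ℕ in atTop, h * (gibbsMean (permStat f n) t / n) < h * c := by
  have hlim := (hφ (t + h)).sub (hφ t)
  have hlt : φ (t + h) - φ t < h * c := by
    have := hg t (t + h)
    nlinarith
  filter_upwards [hlim.eventually (gt_mem_nhds hlt), eventually_gt_atTop 0] with n hn hn0
  have hn0' : (0 : ℝ) < n := by exact_mod_cast hn0
  refine lt_of_le_of_lt ?_ hn
  have h1 := log_sum_exp_add_le (permStat f n) (t + h) t
  have h2 := Zn_sub_Zn_eq (f := f) hn0 (t + h) t
  rw [Zn, Zn] at h2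
  rw [mul_div_assoc', div_le_iff₀ hn0']
  nlinarith

lemma existsUnique_sub_eq_zero {m : ℝ → ℝ} (hm : Continuous m) (hmono : StrictMono m) {s t y : ℝ}
    (hst : s ≤ t) (hs : m s ≤ y) (ht : y ≤ m t) : ∃! r, y - m r = 0 := by
  obtain ⟨r, -, hr⟩ := intermediate_value_Icc hst hm.continuousOn ⟨hs, ht⟩
  refine ⟨r, sub_eq_zero.2 hr.symm, fun r' hr' => hmono.injective ?_⟩
  rw [hr, sub_eq_zero.1 hr']

lemma abs_sub_le_of_strictMono {m : ℝ → ℝ} (hmono : StrictMono m) {θ δ r : ℝ}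
    (h1 : m (θ - δ) ≤ m r) (h2 : m r ≤ m (θ + δ)) : |r - θ| ≤ δ := by
  have := hmono.le_iff_le.1 h1
  have := hmono.le_iff_le.1 h2
  rw [abs_le]
  constructor <;> linarith

lemma eventually_gibbsMean_bounds
    (hφ : ∀ t, Tendsto (fun n => pressure f n t) atTop (𝓝 (φ t)))
    (hg : ∀ s t, φ t + (s - t) * g t ≤ φ s) (hmono : StrictMono g) {δ : ℝ} (hδ : 0 < δ) :
    ∀ᶠ n : ℕ in atTop, gibbsMean (permStat f n) (θ - δ) / n < g (θ - δ / 4) ∧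
      g (θ + δ / 4) < gibbsMean (permStat f n) (θ + δ) / n := by
  have h1 := eventually_gibbsMean_lt hφ hg (t := θ - δ) (h := δ / 2) (c := g (θ - δ / 4)) (by
    have := hmono (show θ - δ + δ / 2 < θ - δ / 4 by linarith)
    nlinarith)
  have h2 := eventually_gibbsMean_lt hφ hg (t := θ + δ) (h := -(δ / 2)) (c := g (θ + δ / 4)) (by
    have := hmono (show θ + δ / 4 < θ + δ + -(δ / 2) by linarith)
    nlinarith)
  filter_upwards [h1, h2] with n hn1 hn2
  constructor <;> nlinarith

lemma strictMono_gibbsMean_div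
    (hmono : StrictMono g) {δ : ℝ} (hδ : 0 < δ) {n : ℕ} (hn0 : 0 < n)
    (hn1 : gibbsMean (permStat f n) (θ - δ) / n < g (θ - δ / 4))
    (hn2 : g (θ + δ / 4) < gibbsMean (permStat f n) (θ + δ) / n) :
    StrictMono fun t => gibbsMean (permStat f n) t / n := by
  have hn0' : (0 : ℝ) < n := by exact_mod_cast hn0
  have h := hn1.trans ((hmono (show θ - δ / 4 < θ + δ / 4 by linarith)).trans hn2)
  have h' := strictMono_gibbsMean_of_lt ((div_lt_div_iff_of_pos_right hn0').1 h)
  exact fun s t hst => div_lt_div_of_pos_right (h' hst) hn0'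

theorem estimators_consistent (hφ : ∀ t, Tendsto (fun n => pressure f n t) atTop (𝓝 (φ t)))
    (hg : ∀ s t, φ t + (s - t) * g t ≤ φ s) (hmono : StrictMono g) (hcont : Continuous g) :
    (Tendsto (fun n : ℕ => Qprob f θ n (fun π => ∃! t : ℝ, permStat f n π / n - g t = 0))
      atTop (𝓝 1)) ∧
    (∀ δ > 0, Tendsto (fun n : ℕ => Qprob f θ n
        (fun π => ∃ t : ℝ, permStat f n π / n - g t = 0 ∧ δ < |t - θ|)) atTop (𝓝 0)) ∧
    (Tendsto (fun n : ℕ => Qprob f θ n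
        (fun π => ∃! t : ℝ, permStat f n π / n - deriv (fun s => Zn f s n) t / n = 0))
      atTop (𝓝 1)) ∧
    (∀ δ > 0, Tendsto (fun n : ℕ => Qprob f θ n
        (fun π => ∃ t : ℝ,
          permStat f n π / n - deriv (fun s => Zn f s n) t / n = 0 ∧ δ < |t - θ|))
      atTop (𝓝 0)) := by
  simp only [deriv_Zn]
  refine ⟨tendsto_Qprob_one hφ hg hmono one_pos (Eventually.of_forall fun n π h1 h2 =>
      existsUnique_sub_eq_zero hcont hmono (by linarith) h1.le h2.le),
    fun δ hδ => tendsto_Qprob_zero hφ hg hmono hδ (Eventually.of_forall fun n π h1 h2 => ?_),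
    tendsto_Qprob_one hφ hg hmono (r := 1 / 4) (by norm_num) ?_,
    fun δ hδ => tendsto_Qprob_zero hφ hg hmono (r := δ / 4) (by positivity) ?_⟩
  · rintro ⟨t, ht, htδ⟩
    rw [sub_eq_zero.1 ht] at h1 h2
    exact absurd (abs_sub_le_of_strictMono hmono h1.le h2.le) (not_le.2 htδ)
  · filter_upwards [eventually_gibbsMean_bounds hφ hg hmono one_pos (θ := θ),
      eventually_gt_atTop 0] with n hn hn0 π h1 h2
    exact existsUnique_sub_eq_zero ((continuous_gibbsMean (permStat f n)).div_const _)
      (strictMono_gibbsMean_div hmono one_pos hn0 hn.1 hn.2) (by linarith : θ - 1 ≤ θ + 1)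
      (hn.1.trans h1).le (h2.trans hn.2).le
  · filter_upwards [eventually_gibbsMean_bounds hφ hg hmono hδ (θ := θ),
      eventually_gt_atTop 0] with n hn hn0 π h1 h2
    rintro ⟨t, ht, htδ⟩
    rw [sub_eq_zero.1 ht] at h1 h2
    exact absurd (abs_sub_le_of_strictMono (strictMono_gibbsMean_div hmono hδ hn0 hn.1 hn.2)
      (hn.1.trans h1).le (h2.trans hn.2).le) (not_le.2 htδ)

end Asymptotics

section Reduction

variable {f : ℝ × ℝ → ℝ}

/-- The projection of the plane onto the unit square. -/
def squareProj (p : ℝ × ℝ) : ℝ × ℝ :=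
  (Set.projIcc 0 1 zero_le_one p.1, Set.projIcc 0 1 zero_le_one p.2)

lemma squareProj_mem (p : ℝ × ℝ) : squareProj p ∈ unitSq :=
  ⟨(Set.projIcc 0 1 zero_le_one p.1).2, (Set.projIcc 0 1 zero_le_one p.2).2⟩

lemma squareProj_of_mem {p : ℝ × ℝ} (hp : p ∈ unitSq) : squareProj p = p := by
  rw [squareProj, Set.projIcc_of_mem _ hp.1, Set.projIcc_of_mem _ hp.2]

lemma uniformContinuous_squareProj : UniformContinuous squareProj := by
  have h : UniformContinuous fun x : ℝ => (Set.projIcc (0 : ℝ) 1 zero_le_one x : ℝ) :=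
    uniformContinuous_subtype_val.comp (LipschitzWith.projIcc _).uniformContinuous
  exact (h.comp uniformContinuous_fst).prodMk (h.comp uniformContinuous_snd)

lemma isCompact_unitSq : IsCompact unitSq := isCompact_Icc.prod isCompact_Icc

lemma uniformContinuous_comp_squareProj (hf : ContinuousOn f unitSq) :
    UniformContinuous (f ∘ squareProj) := by
  have h := isCompact_unitSq.uniformContinuousOn_of_continuous hf
  rw [Metric.uniformContinuousOn_iff] at h
  have h' := Metric.uniformContinuous_iff.1 uniformContinuous_squareProj
  refine Metric.uniformContinuous_iff.2 fun ε hε => ?_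
  obtain ⟨η, hη, h1⟩ := h ε hε
  obtain ⟨δ, hδ, h2⟩ := h' η hη
  exact ⟨δ, hδ, fun a b hab => h1 _ (squareProj_mem a) _ (squareProj_mem b) (h2 hab)⟩

lemma exists_bound_comp_squareProj (hf : ContinuousOn f unitSq) :
    ∃ M > 0, ∀ p, |(f ∘ squareProj) p| ≤ M := by
  obtain ⟨C, hC⟩ := isCompact_unitSq.exists_bound_of_continuousOn hf
  exact ⟨max C 1, by positivity, fun p => (hC _ (squareProj_mem p)).trans (le_max_left _ _)⟩

lemma permStat_comp_squareProj (f : ℝ × ℝ → ℝ) : permStat (f ∘ squareProj) = permStat f := by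
  ext n π
  have h : ∀ i : Fin n, ((i.1 : ℝ) + 1) / n ∈ Set.Icc (0 : ℝ) 1 := fun i => by
    have hi : ((i.1 : ℝ) + 1) ≤ n := by exact_mod_cast i.2
    exact ⟨by positivity, div_le_one_of_le₀ hi (by positivity)⟩
  exact Finset.sum_congr rfl fun i _ => congrArg f (squareProj_of_mem ⟨h i, h (π i)⟩)

lemma Zn_comp_squareProj (f : ℝ × ℝ → ℝ) : Zn (f ∘ squareProj) = Zn f := by
  ext t n
  simp only [Zn, permStat_comp_squareProj]

lemma Qprob_comp_squareProj (f : ℝ × ℝ → ℝ) : Qprob (f ∘ squareProj) = Qprob f := by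
  ext t n p
  simp only [Qprob, Zn_comp_squareProj, permStat_comp_squareProj]

lemma integral_comp_squareProj {μ : Measure (ℝ × ℝ)} (hμ : μ ∈ MM) (f : ℝ × ℝ → ℝ) :
    ∫ p, (f ∘ squareProj) p ∂μ = ∫ p, f p ∂μ := by
  have h1 : MeasurePreserving Prod.fst μ unif01 := ⟨measurable_fst, hμ.2.1⟩
  have h2 : MeasurePreserving Prod.snd μ unif01 := ⟨measurable_snd, hμ.2.2⟩
  refine integral_congr_ae ?_
  filter_upwards [h1.quasiMeasurePreserving.ae ae_unif01_mem,
    h2.quasiMeasurePreserving.ae ae_unif01_mem] with p hp1 hp2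
  rw [Function.comp_apply, squareProj_of_mem ⟨hp1, hp2⟩]

lemma objE_comp_squareProj {μ : Measure (ℝ × ℝ)} (hμ : μ ∈ MM) (f : ℝ × ℝ → ℝ) (t : ℝ) :
    objE (f ∘ squareProj) t μ = objE f t μ := by
  rw [objE, objE, integral_comp_squareProj hμ]

lemma memC.exists_mixedDiff_ne_zero (hf : memC f) :
    ∃ z ∈ unitSq ×ˢ unitSq, mixedDiff (f ∘ squareProj) z ≠ 0 := by
  obtain ⟨hc, ⟨p, hp, hp0⟩, hrow, hcol⟩ := hf
  by_contra! h
  have h4 : ∀ p ∈ unitSq, ∀ q ∈ unitSq, f p - f (p.1, q.2) - f (q.1, p.2) + f q = 0 :=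
    fun p hp q hq => by
      have := h (p, q) ⟨hp, hq⟩
      simp only [mixedDiff, Function.comp_apply] at this
      rw [squareProj_of_mem hp, squareProj_of_mem hq,
        squareProj_of_mem (p := (p.1, q.2)) ⟨hp.1, hq.2⟩,
        squareProj_of_mem (p := (q.1, p.2)) ⟨hq.1, hp.2⟩] at this
      linarith
  have hu : Set.uIcc (0 : ℝ) 1 = Set.Icc 0 1 := Set.uIcc_of_le zero_le_one
  have hirow : ∀ x ∈ Set.Icc (0 : ℝ) 1, IntervalIntegrable (fun z => f (x, z)) volume 0 1 :=
    fun x hx => ContinuousOn.intervalIntegrable (by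
      rw [hu]
      exact hc.comp (by fun_prop) fun z hz => ⟨hx, hz⟩)
  have hicol : ∀ y ∈ Set.Icc (0 : ℝ) 1, IntervalIntegrable (fun z => f (z, y)) volume 0 1 :=
    fun y hy => ContinuousOn.intervalIntegrable (by
      rw [hu]
      exact hc.comp (by fun_prop) fun z hz => ⟨hz, hy⟩)
  have h2 : ∀ x' ∈ Set.Icc (0 : ℝ) 1, f (x', p.2) = f p := fun x' hx' => by
    have h5 : ∫ z in (0 : ℝ)..1, (f (p.1, z) - f (x', z)) =
        ∫ _z in (0 : ℝ)..1, (f p - f (x', p.2)) :=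
      intervalIntegral.integral_congr fun z hz => by
        rw [hu] at hz
        have := h4 p hp (x', z) ⟨hx', hz⟩
        simp only at this ⊢
        linarith
    rw [intervalIntegral.integral_sub (hirow _ hp.1) (hirow _ hx'), hrow _ hp.1, hrow _ hx',
      intervalIntegral.integral_const] at h5
    simp only [sub_zero, one_smul] at h5
    linarith
  have h3 : ∫ z in (0 : ℝ)..1, f (z, p.2) = ∫ _z in (0 : ℝ)..1, f p :=
    intervalIntegral.integral_congr fun z hz => h2 z (hu ▸ hz)
  rw [hcol _ hp.2, intervalIntegral.integral_const] at h3
  simp only [sub_zero, one_smul] at h3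
  exact hp0 h3.symm

end Reduction

section Optimizers

variable {f : ℝ × ℝ → ℝ} {ρ : ℝ → ℝ × ℝ → ℝ} {M : ℝ}

lemma continuous_integral_of_isOpt (hf : Measurable f) (hM0 : 0 < M) (hM : ∀ p, |f p| ≤ M)
    (hρ : ∀ t, IsOpt f t (ρ t)) : Continuous fun t => ∫ p, ρ t p * f p ∂usq := by
  refine (LipschitzWith.of_dist_le_mul (K := (4 * M ^ 2).toNNReal) fun s t => ?_).continuous
  rw [Real.coe_toNNReal _ (by positivity), Real.dist_eq, Real.dist_eq]
  have h := IsOpt.sq_sub_le hf hM0 hM (hρ t) (hρ s)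
  set d := (∫ p, ρ s p * f p ∂usq) - ∫ p, ρ t p * f p ∂usq
  have h1 : |d| * |d| ≤ 4 * M ^ 2 * |s - t| * |d| := by
    have h2 := le_abs_self ((s - t) * d)
    rw [abs_mul] at h2
    rw [← sq, sq_abs]
    nlinarith [mul_le_mul_of_nonneg_left h2 (show 0 ≤ 4 * M ^ 2 by positivity)]
  by_contra! hlt
  have hd : 0 < |d| := lt_of_le_of_lt (by positivity) hlt
  exact absurd (le_of_mul_le_mul_right h1 hd) (not_le.2 hlt)

lemma IsOpt.add_le {ρ σ : ℝ × ℝ → ℝ} {s t : ℝ} (hρ : IsOpt f s ρ) (hσ : IsOpt f t σ) :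
    (t * (∫ p, σ p * f p ∂usq) - ent σ) + (s - t) * (∫ p, σ p * f p ∂usq) ≤
      s * (∫ p, ρ p * f p ∂usq) - ent ρ := by
  linarith [hρ.le σ hσ.dens hσ.int]

end Optimizers

/-- Both estimating equations `LD_n(π,·) = 0` and `ML_n(π,·) = 0` have a
unique root with probability tending to one, and these roots are consistent for `θ₀`.
Here `μf t` denotes the unique maximizer of `μ ↦ t μ[f] − D(μ‖u)` over `𝓜`, so that
`∫ f d(μf t) = Z'(f,t)`. -/
theorem MLE_and_LD_consistent (f : ℝ × ℝ → ℝ) (hf : memC f) (θ₀ : ℝ)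
    (μf : ℝ → Measure (ℝ × ℝ))
    (hμf : ∀ t : ℝ, μf t ∈ MM ∧ ∀ ν ∈ MM, objE f t ν ≤ objE f t (μf t)) :
    (Tendsto (fun n : ℕ => Qprob f θ₀ n
        (fun π => ∃! t : ℝ, permStat f n π / n - ∫ p, f p ∂(μf t) = 0))
      atTop (𝓝 1)) ∧
    (∀ δ > 0, Tendsto (fun n : ℕ => Qprob f θ₀ n
        (fun π => ∃ t : ℝ, permStat f n π / n - ∫ p, f p ∂(μf t) = 0 ∧ δ < |t - θ₀|))
      atTop (𝓝 0)) ∧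
    (Tendsto (fun n : ℕ => Qprob f θ₀ n
        (fun π => ∃! t : ℝ, permStat f n π / n - deriv (fun s => Zn f s n) t / n = 0))
      atTop (𝓝 1)) ∧
    (∀ δ > 0, Tendsto (fun n : ℕ => Qprob f θ₀ n
        (fun π => ∃ t : ℝ,
          permStat f n π / n - deriv (fun s => Zn f s n) t / n = 0 ∧ δ < |t - θ₀|))
      atTop (𝓝 0)) := by
  have huc := uniformContinuous_comp_squareProj hf.1
  obtain ⟨M, hM0, hM⟩ := exists_bound_comp_squareProj hf.1
  have hopt : ∀ t, ∃ ρ, IsOpt (f ∘ squareProj) t ρ ∧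
      ∫ p, (f ∘ squareProj) p ∂(μf t) = ∫ p, ρ p * (f ∘ squareProj) p ∂usq := fun t =>
    exists_isOpt (hμf t).1 fun ν hν => by
      rw [objE_comp_squareProj hν, objE_comp_squareProj (hμf t).1]
      exact (hμf t).2 ν hν
  choose ρ hρ hint using hopt
  have hg : ∀ t, ∫ p, f p ∂(μf t) = ∫ p, ρ t p * (f ∘ squareProj) p ∂usq := fun t => by
    rw [← hint, integral_comp_squareProj (hμf t).1]
  have key := estimators_consistent (θ := θ₀) (fun t => tendsto_pressure huc hM (hρ t))
    (fun s t => IsOpt.add_le (hρ s) (hρ t))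
    (fun s t hst => IsOpt.strictMono hst huc.continuous hM0 hM (hρ s) (hρ t)
      hf.exists_mixedDiff_ne_zero)
    (continuous_integral_of_isOpt huc.continuous.measurable hM0 hM hρ)
  simp only [hg]
  rw [Qprob_comp_squareProj, permStat_comp_squareProj, Zn_comp_squareProj] at key
  exact key
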